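/- arXiv:2009.02924 — 11 statements merged into one kernel-verified Lean document; each statement's English description precedes it below -/
import Mathlib

section
/- Let ω₀ > 0, k_p ∈ ℝ, k_d < −1 and r > 0. Then there exists a sequence (λ_j)_{j∈ℕ} of complex numbers such that for every j, (1 + k_d e^{−λ_j r}) λ_j² + k_p λ_j e^{−λ_j r} − ω₀² = 0, with |Im λ_j| → +∞ and Re λ_j → (1/r)·ln(−k_d) as j → ∞. In particular, since ln(−k_d) > 0, the quasi-polynomial (1 + k_d e^{−λ r})λ² + k_p λ e^{−λ r} − ω₀² has infinitely many zeros with strictly positive real part. -/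
open Filter

lemma aux_implicit (a b r : ℂ) (hr : r ≠ 0) :
    ∃ φ : ℂ → ℂ, Tendsto φ (nhds 0) (nhds 0) ∧
      ∀ᶠ x in nhds (0:ℂ), (1 - Complex.exp (-(φ x) * r)) * (1 + x * φ x) ^ 2
        - a * x * (1 + x * φ x) * Complex.exp (-(φ x) * r) - b * x ^ 2 = 0 := by
  let G : ℂ × ℂ → ℂ := fun p => (1 - Complex.exp (-p.2 * r)) * (1 + p.1 * p.2) ^ 2
        - a * p.1 * (1 + p.1 * p.2) * Complex.exp (-p.2 * r) - b * p.1 ^ 2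
  have hG : ContDiff ℂ 1 G := by fun_prop
  have hs : HasStrictFDerivAt G (fderiv ℂ G (0, 0)) ((0 : ℂ), (0 : ℂ)) :=
    hG.contDiffAt.hasStrictFDerivAt (by simp)
  have h1 : fderiv ℂ G (0, 0) (0, 1) = r := by
    have hc : HasDerivAt (fun w : ℂ => ((0 : ℂ), w)) ((0 : ℂ), (1 : ℂ)) 0 :=
      (hasDerivAt_const (0:ℂ) (0:ℂ)).prodMk (hasDerivAt_id (0:ℂ))
    have h2 : HasDerivAt (fun w : ℂ => G (0, w)) (fderiv ℂ G (0, 0) (0, 1)) 0 :=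
      HasFDerivAt.comp_hasDerivAt (f := fun w : ℂ => ((0 : ℂ), w)) (0:ℂ) hs.hasFDerivAt hc
    have h3 : HasDerivAt (fun w : ℂ => 1 - Complex.exp (-w * r)) r 0 := by
      have := (((hasDerivAt_id (0:ℂ)).neg.mul_const r).cexp).const_sub 1
      simpa using this
    have h4 : (fun w : ℂ => G (0, w)) = fun w : ℂ => 1 - Complex.exp (-w * r) := by
      funext w; simp [G]
    rw [h4] at h2
    exact h2.unique h3
  have hinv : (fderiv ℂ G (0, 0) ∘L .inr ℂ ℂ ℂ).IsInvertible := by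
    refine ⟨ContinuousLinearEquiv.unitsEquivAut ℂ (Units.mk0 r hr), ?_⟩
    ext
    simp [h1]
  refine ⟨hs.implicitFunctionOfProdDomain hinv, hs.tendsto_implicitFunctionOfProdDomain hinv, ?_⟩
  have := hs.eventually_apply_implicitFunctionOfProdDomain hinv
  have h0 : G (0, 0) = 0 := by simp [G]
  rw [h0] at this
  exact this

lemma aux_inf (P : ℂ → Prop) (L : ℝ) (hL : 0 < L) (lam : ℕ → ℂ) (h : ∀ j, P (lam j))
    (h1 : Tendsto (fun j => |(lam j).im|) atTop atTop)
    (h2 : Tendsto (fun j => (lam j).re) atTop (nhds L)) : {z : ℂ | 0 < z.re ∧ P z}.Infinite := by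
  intro hf
  obtain ⟨M, hM⟩ := (hf.image (fun z : ℂ => |z.im|)).bddAbove
  obtain ⟨j, hj1, hj2⟩ := ((h1.eventually_gt_atTop M).and (h2.eventually_const_lt hL)).exists
  exact absurd (hM ⟨lam j, ⟨hj2, h j⟩, rfl⟩) (not_le.mpr hj1)

lemma aux_seq (ω₀ kp kd r : ℝ) (hkd : kd < -1) (hr : 0 < r) :
    ∃ lam : ℕ → ℂ,
      (∀ j : ℕ,
        (1 + (kd : ℂ) * Complex.exp (-(lam j) * (r : ℂ))) * (lam j) ^ 2
          + (kp : ℂ) * (lam j) * Complex.exp (-(lam j) * (r : ℂ)) - ((ω₀ : ℂ)) ^ 2 = 0) ∧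
      Tendsto (fun j => |(lam j).im|) atTop atTop ∧
      Tendsto (fun j => (lam j).re) atTop (nhds (Real.log (-kd) / r)) := by
  have hrC : (r : ℂ) ≠ 0 := by exact_mod_cast hr.ne'
  have hkC : (kd : ℂ) ≠ 0 := by exact_mod_cast (by linarith : kd < 0).ne
  have hL : 0 < Real.log (-kd) := Real.log_pos (by linarith)
  obtain ⟨φ, hφ, hev⟩ := aux_implicit ((kp : ℂ) / kd) ((ω₀ : ℂ) ^ 2) r hrC
  let μ : ℕ → ℂ := fun n => ⟨Real.log (-kd) / r, 2 * Real.pi * n / r⟩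
  have hμ0 : ∀ n, μ n ≠ 0 := fun n h => by
    have := congrArg Complex.re h
    simp only [μ, Complex.zero_re] at this
    exact (div_pos hL hr).ne' this
  have him : Tendsto (fun n => (μ n).im) atTop atTop := by
    have : Tendsto (fun n : ℕ => (2 * Real.pi / r) * (n : ℝ)) atTop atTop :=
      tendsto_natCast_atTop_atTop.const_mul_atTop (by positivity)
    refine this.congr fun n => ?_
    simp only [μ]; ring
  have hinv : Tendsto (fun n => (μ n)⁻¹) atTop (nhds 0) := by
    refine tendsto_inv₀_cobounded.comp ?_
    rw [← tendsto_norm_atTop_iff_cobounded]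
    exact tendsto_atTop_mono (fun n => (le_abs_self _).trans (Complex.abs_im_le_norm _)) him
  have hexp : ∀ n, Complex.exp (-(μ n) * r) = -1 / kd := by
    intro n
    have h1 : -(μ n) * r = -((Real.log (-kd) : ℝ) : ℂ) - n * (2 * Real.pi * Complex.I) := by
      apply Complex.ext <;> simp [μ] <;> field_simp
    rw [h1, Complex.exp_periodic.sub_nat_mul_eq, ← Complex.ofReal_neg, ← Complex.ofReal_exp,
      Real.exp_neg, Real.exp_log (by linarith)]
    push_cast
    field_simp
  have hw := hφ.comp hinv
  obtain ⟨N, hN⟩ := eventually_atTop.1 (hinv.eventually hev)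
  have hre0 : Tendsto (fun n => (φ (μ n)⁻¹).re) atTop (nhds 0) :=
    (Complex.continuous_re.tendsto _).comp hw
  have him0 : Tendsto (fun n => (φ (μ n)⁻¹).im) atTop (nhds 0) :=
    (Complex.continuous_im.tendsto _).comp hw
  refine ⟨fun j => μ (j + N) + φ (μ (j + N))⁻¹, fun j => ?_, ?_, ?_⟩
  · beta_reduce
    have h := hN (j + N) (by omega)
    have hm := hμ0 (j + N)
    have he := hexp (j + N)
    generalize μ (j + N) = m at *
    generalize φ m⁻¹ = w at *
    have : Complex.exp (-(m + w) * r) = -1 / kd * Complex.exp (-w * r) := by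
      rw [← he, ← Complex.exp_add]; ring_nf
    rw [this]
    generalize Complex.exp (-w * r) = E at *
    have h5 : (1 + m⁻¹ * w) * m = m + w := by field_simp
    have h6 : ((1 - E) * (1 + m⁻¹ * w) ^ 2 - kp / kd * m⁻¹ * (1 + m⁻¹ * w) * E
      - ω₀ ^ 2 * m⁻¹ ^ 2) * m ^ 2 = 0 := by rw [h]; ring
    rw [← h6]
    field_simp
    ring
  · refine tendsto_abs_atTop_atTop.comp ?_
    exact (tendsto_add_atTop_iff_nat N (f := fun n => (μ n + φ (μ n)⁻¹).im)).2
      (by simpa using him.atTop_add him0)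
  · refine (tendsto_add_atTop_iff_nat N (f := fun n => (μ n + φ (μ n)⁻¹).re)).2 ?_
    simpa [μ] using hre0.const_add (Real.log (-kd) / r)


/-- Under delayed PD feedback the quasi-polynomial
`(1 + k_d e^{−λr})λ² + k_p λ e^{−λr} − ω₀²` has a sequence of zeros whose
imaginary parts blow up and whose real parts converge to `ln(−k_d)/r > 0`;
in particular it has infinitely many zeros with strictly positive real part. -/
theorem stmt1 (ω₀ kp kd r : ℝ) (hω : 0 < ω₀) (hkd : kd < -1) (hr : 0 < r) :
    (∃ lam : ℕ → ℂ,
      (∀ j : ℕ,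
        (1 + (kd : ℂ) * Complex.exp (-(lam j) * (r : ℂ))) * (lam j) ^ 2
          + (kp : ℂ) * (lam j) * Complex.exp (-(lam j) * (r : ℂ)) - ((ω₀ : ℂ)) ^ 2 = 0) ∧
      Tendsto (fun j => |(lam j).im|) atTop atTop ∧
      Tendsto (fun j => (lam j).re) atTop (nhds (Real.log (-kd) / r))) ∧
    0 < Real.log (-kd) ∧
    {z : ℂ | 0 < z.re ∧
      (1 + (kd : ℂ) * Complex.exp (-z * (r : ℂ))) * z ^ 2
        + (kp : ℂ) * z * Complex.exp (-z * (r : ℂ)) - ((ω₀ : ℂ)) ^ 2 = 0}.Infinite := by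

  have hL : 0 < Real.log (-kd) := Real.log_pos (by linarith)
  obtain ⟨lam, h1, h2, h3⟩ := aux_seq ω₀ kp kd r hkd hr
  exact ⟨⟨lam, h1, h2, h3⟩, hL, aux_inf (fun z => (1 + (kd : ℂ) * Complex.exp (-z * (r : ℂ))) * z ^ 2
        + (kp : ℂ) * z * Complex.exp (-z * (r : ℂ)) - ((ω₀ : ℂ)) ^ 2 = 0) _ (div_pos hL hr) lam h1 h2 h3⟩
end

section
/- Let ω₀ > 0, k_p < 0 and k_d < −1. Then for every M > 0 there exists r̂ > 0 such that for every r ∈ (0, r̂) there exists a real number λ > M with λ² + (k_p + k_d (1 − e^{−λ r})/r) λ − ω₀² = 0. In other words, the unstable real characteristic root produced by the finite-difference approximation moves to +∞ as r → 0+. -/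
/-- The unstable real root of `λ² + (k_p + k_d (1 − e^{−λr})/r) λ − ω₀²`
produced by the finite-difference approximation moves to `+∞` as `r → 0+`:
for every `M > 0` there is `r̂ > 0` such that for every `r ∈ (0, r̂)` there is
a real root `λ > M`. -/
theorem stmt3 (ω₀ kp kd : ℝ) (hω : 0 < ω₀) (hkp : kp < 0) (hkd : kd < -1) :
    ∀ M : ℝ, 0 < M → ∃ rhat : ℝ, 0 < rhat ∧ ∀ r : ℝ, 0 < r → r < rhat →
      ∃ lam : ℝ, M < lam ∧
        lam ^ 2 + (kp + kd * (1 - Real.exp (-lam * r)) / r) * lam - ω₀ ^ 2 = 0 := by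
  intro M hM
  refine ⟨(-kd - 1) / M, div_pos (by linarith) hM, ?_⟩
  intro r hr hr2
  have hMr : r * M < -kd - 1 := (lt_div_iff₀ hM).mp hr2
  set f : ℝ → ℝ := fun lam =>
    lam ^ 2 + (kp + kd * (1 - Real.exp (-lam * r)) / r) * lam - ω₀ ^ 2 with hf
  have hcont : Continuous f := by
    rw [hf]; fun_prop
  have hpos : 0 < 1 + M * r := by positivity
  have hfM : f M < 0 := by
    have he : Real.exp (-M * r) ≤ 1 / (1 + M * r) := by
      have h1 : M * r + 1 ≤ Real.exp (M * r) := Real.add_one_le_exp _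
      rw [neg_mul, Real.exp_neg, ← one_div]
      exact one_div_le_one_div_of_le hpos (by linarith)
    have h2 : M * r ≤ (-kd) * (1 - Real.exp (-M * r)) := by
      have h3 : M * r / (1 + M * r) ≤ 1 - Real.exp (-M * r) := by
        have : M * r / (1 + M * r) = 1 - 1 / (1 + M * r) := by field_simp; ring
        linarith
      have h4 : M * r ≤ (-kd) * (M * r / (1 + M * r)) := by
        rw [← mul_div_assoc, le_div_iff₀ hpos]
        have : 0 < M * r := by positivity
        nlinarith
      have h5 := mul_le_mul_of_nonneg_left h3 (show 0 ≤ -kd by linarith)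
      linarith
    have h6 : kd * (1 - Real.exp (-M * r)) / r ≤ -M := by
      rw [div_le_iff₀ hr]; linarith
    have h7 := mul_le_mul_of_nonneg_right h6 hM.le
    have h8 : kp * M < 0 := mul_neg_of_neg_of_pos hkp hM
    have h9 : 0 < ω₀ ^ 2 := by positivity
    simp only [hf]
    nlinarith
  have hq : 0 < -kd / r := div_pos (by linarith) hr
  obtain ⟨b, hb⟩ : ∃ b, b = M + ω₀ + (-kp) + (-kd) / r := ⟨_, rfl⟩
  have hbM : M ≤ b := by linarith
  have hfb : 0 ≤ f b := by
    have h1 : kd / r ≤ kd * (1 - Real.exp (-b * r)) / r := by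
      apply div_le_div_of_nonneg_right _ hr.le
      have := Real.exp_pos (-b * r)
      nlinarith
    have h2 : kd / r = -(-kd / r) := by ring
    have h3 := mul_le_mul_of_nonneg_right h1 (show 0 ≤ b by linarith)
    have h4 : kd / r = M + ω₀ - kp - b := by linarith
    rw [h4] at h3
    have h5 : ω₀ * ω₀ ≤ b * (M + ω₀) :=
      mul_le_mul (by linarith) (by linarith) hω.le (by linarith)
    simp only [hf]
    nlinarith
  obtain ⟨x, hx, hx0⟩ := intermediate_value_Icc hbM hcont.continuousOn
    (show (0 : ℝ) ∈ Set.Icc (f M) (f b) from ⟨hfM.le, hfb⟩)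
  refine ⟨x, lt_of_le_of_ne hx.1 ?_, hx0⟩
  intro h
  rw [← h] at hx0
  linarith
end

section
/- (Proposition 3.2.) Assume the nominal closed loop is exponentially stable, i.e. there exists δ > 0 such that every λ ∈ ℂ with H₀(λ) = 0 satisfies Re λ ≤ −δ. If B·K_d·C has at least one complex eigenvalue lying outside the closure of the set S, then there exists r̂ > 0 such that for every r ∈ (0, r̂) there exists λ ∈ ℂ with Re λ > 0 and H₂(λ; r) = 0; that is, the closed loop with the finite-difference approximation of the derivative is unstable for all sufficiently small steps r. -/
open Matrix

/-- A real matrix regarded as a complex matrix. -/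
noncomputable def cM {a b : ℕ} (M : Matrix (Fin a) (Fin b) ℝ) : Matrix (Fin a) (Fin b) ℂ :=
  M.map (fun x => (x : ℂ))

/-- The nominal closed-loop characteristic function `H₀`. -/
noncomputable def H0 {n m p q K : ℕ}
    (A0 : Matrix (Fin n) (Fin n) ℝ) (A : Fin K → Matrix (Fin n) (Fin n) ℝ)
    (τ : Fin K → ℝ)
    (B : Matrix (Fin n) (Fin m) ℝ) (C : Matrix (Fin p) (Fin n) ℝ)
    (Kp Kd : Matrix (Fin m) (Fin p) ℝ)
    (Ui : Matrix (Fin m) (Fin q) ℝ) (Vi : Matrix (Fin q) (Fin p) ℝ)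
    (lam : ℂ) : ℂ :=
  (lam • Matrix.fromBlocks (1 - cM B * cM Kd * cM C) 0 0 (1 : Matrix (Fin q) (Fin q) ℂ)
    - Matrix.fromBlocks (cM A0 + cM B * cM Kp * cM C) (cM B * cM Ui) (cM Vi * cM C) 0
    - ∑ k : Fin K, Complex.exp (-lam * (τ k : ℂ)) •
        Matrix.fromBlocks (cM (A k)) 0 0 (0 : Matrix (Fin q) (Fin q) ℂ)).det

open Classical in
/-- The set `S` of Proposition 3.2. -/
noncomputable def Sset : Set ℂ :=
  {lam : ℂ | lam.im ∈ Set.Ioo (-Real.pi) Real.pi ∧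
    lam.re < (if lam.im = 0 then 1 else lam.im * Real.cot lam.im)}

/-- The characteristic function `H₂(λ; r)` of the closed loop in which the derivative
is replaced by the finite difference `(y(t) − y(t−r))/r`. -/
noncomputable def H2 {n m p q K : ℕ}
    (A0 : Matrix (Fin n) (Fin n) ℝ) (A : Fin K → Matrix (Fin n) (Fin n) ℝ)
    (τ : Fin K → ℝ)
    (B : Matrix (Fin n) (Fin m) ℝ) (C : Matrix (Fin p) (Fin n) ℝ)
    (Kp Kd : Matrix (Fin m) (Fin p) ℝ)
    (Ui : Matrix (Fin m) (Fin q) ℝ) (Vi : Matrix (Fin q) (Fin p) ℝ)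
    (lam : ℂ) (r : ℝ) : ℂ :=
  (lam • ((1 : Matrix (Fin n ⊕ Fin q) (Fin n ⊕ Fin q) ℂ)
      - ((1 - Complex.exp (-lam * (r : ℂ))) / (lam * (r : ℂ))) •
          Matrix.fromBlocks (cM B * cM Kd * cM C) 0 0 (0 : Matrix (Fin q) (Fin q) ℂ))
    - Matrix.fromBlocks (cM A0 + cM B * cM Kp * cM C) (cM B * cM Ui) (cM Vi * cM C) 0
    - ∑ k : Fin K, Complex.exp (-lam * (τ k : ℂ)) •
        Matrix.fromBlocks (cM (A k)) 0 0 (0 : Matrix (Fin q) (Fin q) ℂ)).det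

/-- normalized real part function -/
noncomputable def uF (N x : ℝ) : ℝ := x * Real.exp x / N

/-- angle function -/
noncomputable def phiF (N x : ℝ) : ℝ :=
  N * Real.exp (-x) * Real.sin (Real.arccos (uF N x)) + Real.arccos (uF N x)

lemma uF_cont (N : ℝ) : Continuous (uF N) := by
  unfold uF; fun_prop

lemma phiF_cont (N : ℝ) : Continuous (phiF N) := by
  have := uF_cont N
  have h2 := Real.continuous_arccos.comp this
  unfold phiF
  exact ((continuous_const.mul (Real.continuous_exp.comp continuous_neg)).mul
    (Real.continuous_sin.comp h2)).add h2

lemma phiF_of_ge {N x : ℝ} (h : 1 ≤ uF N x) : phiF N x = 0 := by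
  unfold phiF; rw [Real.arccos_eq_zero.2 h]; simp

lemma phiF_of_le {N x : ℝ} (h : uF N x ≤ -1) : phiF N x = Real.pi := by
  unfold phiF; rw [Real.arccos_eq_pi.2 h]; simp

lemma exists_x (N a φ : ℝ) (hN : 0 < N) (ha : uF N a < 1) (hb : Real.pi < phiF N a)
    (h0 : 0 ≤ φ) (h1 : φ ≤ Real.pi) :
    ∃ x, a < x ∧ -1 ≤ uF N x ∧ uF N x ≤ 1 ∧ phiF N x = φ := by
  obtain ⟨b, hab, hub⟩ : ∃ b, a < b ∧ 1 ≤ uF N b := by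
    refine ⟨max (a+1) N, lt_of_lt_of_le (by linarith) (le_max_left _ _), ?_⟩
    unfold uF
    rw [le_div_iff₀ hN]
    have h1 : N ≤ max (a+1) N := le_max_right _ _
    have h2 : 1 ≤ Real.exp (max (a+1) N) := Real.one_le_exp (by linarith)
    nlinarith
  have hfb := phiF_of_ge hub
  rcases eq_or_lt_of_le h0 with h0 | h0
  · obtain ⟨x, hx, hux⟩ := intermediate_value_Icc hab.le (uF_cont N).continuousOn ⟨ha.le, hub⟩
    refine ⟨x, lt_of_le_of_ne hx.1 ?_, by linarith, hux.le, ?_⟩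
    · rintro rfl; linarith
    · rw [phiF_of_ge hux.ge, h0]
  · obtain ⟨x, hx, hpx⟩ := intermediate_value_Icc' hab.le (phiF_cont N).continuousOn
      (show φ ∈ Set.Icc (phiF N b) (phiF N a) from ⟨by linarith, by linarith⟩)
    have hax : a < x := lt_of_le_of_ne hx.1 (by rintro rfl; linarith)
    have hx1 : uF N x ≤ 1 := by
      by_contra! h
      have := phiF_of_ge h.le
      linarith
    by_cases hx2 : -1 ≤ uF N x
    · exact ⟨x, hax, hx2, hx1, hpx⟩
    · push Not at hx2
      have hp := phiF_of_le hx2.le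
      obtain ⟨x', hx', hux⟩ := intermediate_value_Icc hx.2 (uF_cont N).continuousOn
        (show (-1:ℝ) ∈ Set.Icc _ _ from ⟨hx2.le, by linarith⟩)
      exact ⟨x', by linarith [hx'.1], hux.ge, by linarith, by rw [phiF_of_le hux.le, ← hp, hpx]⟩

lemma w_eq (N x : ℝ) (hN : 0 < N) (h1 : -1 ≤ uF N x) (h2 : uF N x ≤ 1) :
    ∃ w : ℂ, w.re = x ∧ w * Complex.exp w = N * Complex.exp (phiF N x * Complex.I) := by
  set α := Real.arccos (uF N x) with hα
  have hc : Real.cos α = uF N x := Real.cos_arccos h1 h2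
  have hx : x = N * Real.exp (-x) * Real.cos α := by
    rw [hc, uF, Real.exp_neg]; field_simp
  refine ⟨⟨x, N * Real.exp (-x) * Real.sin α⟩, rfl, ?_⟩
  have hw : (⟨x, N * Real.exp (-x) * Real.sin α⟩ : ℂ) =
      N * Complex.exp (-x) * Complex.exp (α * Complex.I) := by
    rw [Complex.exp_mul_I, ← Complex.ofReal_cos, ← Complex.ofReal_sin, ← Complex.ofReal_neg,
      ← Complex.ofReal_exp]
    apply Complex.ext
    · simp [-Complex.ofReal_exp, -Complex.ofReal_cos, -Complex.ofReal_sin, -Complex.ofReal_neg]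
      linarith [hx]
    · simp [-Complex.ofReal_exp, -Complex.ofReal_cos, -Complex.ofReal_sin, -Complex.ofReal_neg]
  have hw2 : (⟨x, N * Real.exp (-x) * Real.sin α⟩ : ℂ) =
      x + (N * Real.exp (-x) * Real.sin α : ℝ) * Complex.I := by
    apply Complex.ext
    · rw [Complex.add_re, Complex.re_ofReal_mul, Complex.I_re, Complex.ofReal_re]; simp
    · rw [Complex.add_im, Complex.im_ofReal_mul, Complex.I_im, Complex.ofReal_im]; simp
  have : (⟨x, N * Real.exp (-x) * Real.sin α⟩ : ℂ) *
      Complex.exp (⟨x, N * Real.exp (-x) * Real.sin α⟩ : ℂ) =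
      (N * Complex.exp (-x) * Complex.exp (α * Complex.I)) *
      Complex.exp (x + (N * Real.exp (-x) * Real.sin α : ℝ) * Complex.I) := by
    rw [← hw2, ← hw]
  rw [this, mul_assoc, mul_assoc, ← Complex.exp_add, ← Complex.exp_add]
  congr 2
  unfold phiF
  rw [← hα]
  push_cast
  ring

lemma lambert_upper (z : ℂ) (hy : 0 < z.im)
    (hz : z.im < Real.pi → z.re * Real.sin z.im < - z.im * Real.cos z.im) :
    ∃ w : ℂ, z.re < w.re ∧ w * Complex.exp w = z * Complex.exp z := by
  have hz0 : z ≠ 0 := by rintro rfl; simp at hy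
  have hR : 0 < ‖z‖ := norm_pos_iff.2 hz0
  set v := z * Complex.exp z with hv
  set N := ‖v‖ with hN
  have hNe : N = ‖z‖ * Real.exp z.re := by rw [hN, hv, norm_mul, Complex.norm_exp]
  have hN0 : 0 < N := by rw [hNe]; positivity
  have hu : uF N z.re = z.re / ‖z‖ := by
    unfold uF; rw [hNe]; field_simp
  have habs : |z.re| < ‖z‖ := by
    rw [Complex.abs_re_lt_norm]; exact hy.ne'
  have habs' := abs_lt.1 habs
  have hu1 : uF N z.re < 1 := by rw [hu, div_lt_one hR]; exact habs'.2
  have hu2 : -1 < uF N z.re := by rw [hu, lt_div_iff₀ hR]; linarith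
  set α := Real.arccos (uF N z.re) with hα
  have hc : ‖z‖ * Real.cos α = z.re := by
    rw [hα, Real.cos_arccos hu2.le hu1.le, hu]; field_simp
  have hα0 : 0 < α := Real.arccos_pos.2 hu1
  have hαpi : α < Real.pi := lt_of_le_of_ne (Real.arccos_le_pi _)
    (fun h => by have := Real.arccos_eq_pi.1 h; linarith)
  have hs0 : 0 < Real.sin α := Real.sin_pos_of_pos_of_lt_pi hα0 hαpi
  have hs : ‖z‖ * Real.sin α = z.im := by
    have h1 : (‖z‖ * Real.sin α)^2 = z.im^2 := by
      have h3 := Complex.sq_norm z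
      rw [Complex.normSq_apply] at h3
      have := Real.sin_sq_add_cos_sq α
      have h4 : (‖z‖ * Real.sin α)^2 = ‖z‖^2 - (‖z‖*Real.cos α)^2 := by
        rw [mul_pow, mul_pow, eq_sub_iff_add_eq.2 this]; ring
      rw [h4, hc, h3]; ring
    exact (pow_left_inj₀ (by positivity) hy.le two_ne_zero).1 h1
  have hphi : phiF N z.re = z.im + α := by
    unfold phiF
    rw [← hα, ← hs, hNe, Real.exp_neg]; field_simp
  have hbeta : Real.pi < phiF N z.re := by
    rw [hphi]
    by_cases hyp : z.im < Real.pi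
    · have h := hz hyp
      by_contra! hle
      have h1 : 0 ≤ Real.sin (z.im + α) :=
        Real.sin_nonneg_of_nonneg_of_le_pi (by linarith) hle
      have h2 : ‖z‖ * Real.sin (z.im + α) = z.re * Real.sin z.im + z.im * Real.cos z.im := by
        rw [Real.sin_add]
        linear_combination Real.sin z.im * hc + Real.cos z.im * hs
      have h3 : 0 ≤ ‖z‖ * Real.sin (z.im + α) := by positivity
      linarith
    · linarith
  obtain ⟨x, hx, hx1, hx2, hx3⟩ := exists_x N z.re |v.arg| hN0 hu1 hbeta (abs_nonneg _)
    (Complex.abs_arg_le_pi v)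
  obtain ⟨w, hw, hwe⟩ := w_eq N x hN0 hx1 hx2
  rw [hx3] at hwe
  have hve := Complex.norm_mul_exp_arg_mul_I v
  rcases abs_cases v.arg with h | h
  · refine ⟨w, by rw [hw]; exact hx, ?_⟩
    rw [hwe, h.1, hN, hve]
  · refine ⟨(starRingEnd ℂ) w, by rw [Complex.conj_re, hw]; exact hx, ?_⟩
    rw [Complex.exp_conj, ← map_mul, hwe, h.1]
    rw [map_mul, ← Complex.exp_conj, Complex.conj_ofReal, map_mul, Complex.conj_ofReal,
      Complex.conj_I]
    push_cast
    rw [neg_mul_neg, hN, hve]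

lemma lambert_real (a : ℝ) (ha : a < -1) :
    ∃ x : ℝ, a < x ∧ x * Real.exp x = a * Real.exp a := by
  have hc : Continuous (fun x : ℝ => x * Real.exp x) := by fun_prop
  have h1 : -1 * Real.exp (-1) ≤ a * Real.exp a := by
    have := Real.add_one_le_exp (-1 - a)
    have h2 : Real.exp (-1) = Real.exp (-1 - a) * Real.exp a := by
      rw [← Real.exp_add]; ring_nf
    rw [h2]
    nlinarith [Real.exp_pos a]
  obtain ⟨x, hx, hxe⟩ := intermediate_value_Icc (show (-1:ℝ) ≤ 0 by norm_num) hc.continuousOn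
    (show a * Real.exp a ∈ Set.Icc _ _ from ⟨h1, by nlinarith [Real.exp_pos a]⟩)
  exact ⟨x, by linarith [hx.1], hxe⟩

lemma not_closure (μ : ℂ) (h : μ ∉ closure Sset) (h1 : μ.im ∈ Set.Ioo (-Real.pi) Real.pi) :
    (if μ.im = 0 then 1 else μ.im * Real.cot μ.im) < μ.re := by
  by_contra! hle
  apply h
  have ht : Filter.Tendsto (fun e : ℝ => μ - (e : ℂ)) (nhdsWithin 0 (Set.Ioi 0)) (nhds μ) := by
    have : Continuous (fun e : ℝ => μ - (e : ℂ)) := by fun_prop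
    have h2 := this.tendsto 0
    simp only [Complex.ofReal_zero, sub_zero] at h2
    exact h2.mono_left nhdsWithin_le_nhds
  refine mem_closure_of_tendsto ht ?_
  filter_upwards [self_mem_nhdsWithin] with e he
  have he : 0 < e := he
  unfold Sset
  simp only [Set.mem_setOf_eq, Complex.sub_im, Complex.ofReal_im, sub_zero, Complex.sub_re,
    Complex.ofReal_re]
  refine ⟨h1, lt_of_lt_of_le (sub_lt_self _ he) ?_⟩
  convert hle

lemma exists_s (μ : ℂ) (h : μ ∉ closure Sset) :
    ∃ s : ℂ, 0 < s.re ∧ s = μ * (1 - Complex.exp (-s)) := by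
  suffices H : ∃ w : ℂ, (-μ).re < w.re ∧ w * Complex.exp w = (-μ) * Complex.exp (-μ) by
    obtain ⟨w, hw, hwe⟩ := H
    refine ⟨w + μ, ?_, ?_⟩
    · simp at hw ⊢; linarith
    · have : w = -μ * Complex.exp (-(w + μ)) := by
        have h3 : -(w+μ) = -μ + -w := by ring
        rw [h3, Complex.exp_add, ← mul_assoc, ← hwe, mul_assoc, ← Complex.exp_add]; simp
      linear_combination this
  have key := not_closure μ h
  have hsc : ∀ y : ℝ, Real.sin y ≠ 0 → Real.cot y * Real.sin y = Real.cos y := by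
    intro y hy; rw [Real.cot_eq_cos_div_sin]; field_simp
  rcases lt_trichotomy μ.im 0 with hy | hy | hy
  · refine lambert_upper (-μ) (by simpa using hy) ?_
    intro hlt
    simp only [Complex.neg_im, Complex.neg_re, Real.sin_neg, Real.cos_neg] at *
    have h1 := key ⟨by linarith, by linarith [Real.pi_pos]⟩
    rw [if_neg hy.ne] at h1
    have hs : Real.sin μ.im < 0 := Real.sin_neg_of_neg_of_neg_pi_lt hy (by linarith)
    have := hsc μ.im hs.ne
    have h2 := mul_lt_mul_of_neg_right h1 hs
    rw [mul_assoc, this] at h2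
    linarith
  · have h1 := key (by rw [hy]; exact ⟨by linarith [Real.pi_pos], Real.pi_pos⟩)
    rw [if_pos hy] at h1
    obtain ⟨x, hx, hxe⟩ := lambert_real (-μ.re) (by linarith)
    have hμ : -μ = ((-μ.re : ℝ) : ℂ) := by apply Complex.ext <;> simp [hy]
    refine ⟨x, by simpa using hx, ?_⟩
    rw [hμ, ← Complex.ofReal_exp, ← Complex.ofReal_exp, ← Complex.ofReal_mul, hxe]
    push_cast; rfl
  · obtain ⟨w, hw, hwe⟩ := lambert_upper ((starRingEnd ℂ) (-μ)) (by simpa using hy) (by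
      intro hlt
      simp only [map_neg, Complex.neg_im, Complex.neg_re, Complex.conj_im, Complex.conj_re,
        neg_neg] at *
      have h1 := key ⟨by linarith, by linarith [Real.pi_pos]⟩
      rw [if_neg hy.ne'] at h1
      have hs : 0 < Real.sin μ.im := Real.sin_pos_of_pos_of_lt_pi hy (by linarith)
      have := hsc μ.im hs.ne'
      have h2 := mul_lt_mul_of_pos_right h1 hs
      rw [mul_assoc, this] at h2
      linarith)
    refine ⟨(starRingEnd ℂ) w, by simpa using hw, ?_⟩
    rw [Complex.exp_conj, ← map_mul, hwe, Complex.exp_conj, ← map_mul, Complex.conj_conj]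

lemma det_diff {ι : Type*} [Fintype ι] [DecidableEq ι] (M : ℂ → Matrix ι ι ℂ)
    (h : ∀ i j, Differentiable ℂ (fun s => M s i j)) : Differentiable ℂ (fun s => (M s).det) := by
  simp only [Matrix.det_apply]
  refine Differentiable.fun_sum fun σ _ => ?_
  refine Differentiable.fun_const_smul ?_ _
  exact Differentiable.fun_finsetProd fun i _ => h _ _

/-- Hurwitz-type argument. -/
lemma perturb {ι : Type*} [Fintype ι] [DecidableEq ι] {K : ℕ} (D M : Matrix ι ι ℂ)
    (A : Fin K → Matrix ι ι ℂ) (τ : Fin K → ℝ) (hτ : ∀ k, 0 < τ k)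
    (s0 : ℂ) (hs0 : 0 < s0.re)
    (hz : (s0 • (1 : Matrix ι ι ℂ) - (1 - Complex.exp (-s0)) • D).det = 0) :
    ∃ rhat : ℝ, 0 < rhat ∧ ∀ r : ℝ, 0 < r → r < rhat → ∃ s : ℂ, 0 < s.re ∧
      (s • (1 : Matrix ι ι ℂ) - (1 - Complex.exp (-s)) • D - (r : ℂ) • M
        - ∑ k, ((r : ℂ) * Complex.exp (-(s / r) * (τ k : ℂ))) • A k).det = 0 := by
  set f : ℂ → ℂ := fun s => (s • (1 : Matrix ι ι ℂ) - (1 - Complex.exp (-s)) • D).det with hf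
  have hfd : Differentiable ℂ f := by
    apply det_diff
    intro i j
    simp only [Matrix.sub_apply, Matrix.smul_apply, smul_eq_mul]
    fun_prop
  have hfa : AnalyticOnNhd ℂ f Set.univ := hfd.differentiableOn.analyticOnNhd isOpen_univ
  have hiso : ∀ᶠ z in nhdsWithin s0 {s0}ᶜ, f z ≠ 0 := by
    rcases (hfa s0 trivial).eventually_eq_zero_or_eventually_ne_zero with h | h
    · exfalso
      have h0 : f = 0 := hfa.eq_of_eventuallyEq (analyticOnNhd_const (v := (0:ℂ))) h
      have h1 : f (-(2 * Real.pi * Complex.I)) = 0 := by rw [h0]; rfl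
      simp only [hf, neg_neg, Complex.exp_two_pi_mul_I, sub_self, zero_smul, sub_zero] at h1
      rw [Matrix.det_smul, Matrix.det_one, mul_one] at h1
      have h2 : (-(2 * Real.pi * Complex.I) : ℂ) ≠ 0 := neg_ne_zero.2 Complex.two_pi_I_ne_zero
      exact pow_ne_zero _ h2 h1
    · exact h
  rw [eventually_nhdsWithin_iff, Metric.eventually_nhds_iff] at hiso
  obtain ⟨d, hd, hiso⟩ := hiso
  set ρ := min (d/2) (s0.re/2) with hρ
  have hρ0 : 0 < ρ := by positivity
  have hρd : ρ < d := lt_of_le_of_lt (min_le_left _ _) (by linarith)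
  have hρs : ρ < s0.re := lt_of_le_of_lt (min_le_right _ _) (by linarith)
  have hsph : ∀ z ∈ Metric.sphere s0 ρ, f z ≠ 0 := by
    intro z hzz
    have : dist z s0 = ρ := hzz
    apply hiso (by rw [this]; exact hρd)
    rintro rfl
    simp at this; linarith
  have hre : ∀ z ∈ Metric.closedBall s0 ρ, 0 < z.re := by
    intro z hzz
    have h1 : ‖z - s0‖ ≤ ρ := by rw [← dist_eq_norm]; exact hzz
    have h2 := Complex.abs_re_le_norm (z - s0)
    have h3 := abs_le.1 (h2.trans h1)
    simp at h3; linarith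
  obtain ⟨ε, hε, hmin⟩ : ∃ ε > 0, ∀ z ∈ Metric.sphere s0 ρ, ε ≤ ‖f z‖ := by
    obtain ⟨z, hz1, hz2⟩ := (isCompact_sphere s0 ρ).exists_isMinOn
      (NormedSpace.sphere_nonempty.2 hρ0.le) hfd.continuous.norm.continuousOn
    exact ⟨‖f z‖, norm_pos_iff.2 (hsph z hz1), fun y hy => hz2 hy⟩
  set F : (ℂ × (Fin K → ℂ)) → ℂ → ℂ := fun c s =>
    (s • (1 : Matrix ι ι ℂ) - (1 - Complex.exp (-s)) • D - c.1 • M - ∑ k, c.2 k • A k).det with hF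
  have hFc : Continuous (fun p : (ℂ × (Fin K → ℂ)) × ℂ => F p.1 p.2) := by
    simp only [hF]
    apply Continuous.matrix_det
    fun_prop
  have hF0 : ∀ s, F 0 s = f s := by intro s; simp [hF, hf]
  have hev : ∀ᶠ c in nhds (0 : ℂ × (Fin K → ℂ)), ∀ s ∈ Metric.closedBall s0 ρ,
      ‖F c s - f s‖ < ε / 8 := by
    apply (isCompact_closedBall s0 ρ).eventually_forall_of_forall_eventually
    intro s _
    have hc : Continuous (fun p : (ℂ × (Fin K → ℂ)) × ℂ => ‖F p.1 p.2 - f p.2‖) :=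
      (hFc.sub (hfd.continuous.comp continuous_snd)).norm
    have := hc.tendsto (0, s)
    simp only [hF0, sub_self, norm_zero] at this
    exact this.eventually (gt_mem_nhds (by positivity))
  rw [Metric.eventually_nhds_iff] at hev
  obtain ⟨η, hη, hev⟩ := hev
  refine ⟨η, hη, fun r hr hrη => ?_⟩
  set g : ℂ → ℂ := fun s => (s • (1 : Matrix ι ι ℂ) - (1 - Complex.exp (-s)) • D - (r : ℂ) • M
        - ∑ k, ((r : ℂ) * Complex.exp (-(s / r) * (τ k : ℂ))) • A k).det with hg
  have hgd : Differentiable ℂ g := by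
    apply det_diff
    intro i j
    simp only [Matrix.sub_apply, Matrix.smul_apply, smul_eq_mul, Matrix.sum_apply]
    fun_prop
  have hclose : ∀ s ∈ Metric.closedBall s0 ρ, ‖g s - f s‖ < ε / 8 := by
    intro s hs
    refine hev (y := ((r : ℂ), fun k => (r : ℂ) * Complex.exp (-(s / r) * (τ k : ℂ)))) ?_ s hs
    rw [dist_zero_right]
    refine lt_of_le_of_lt ?_ hrη
    have hrn : ‖(r : ℂ)‖ = r := by rw [Complex.norm_real, Real.norm_of_nonneg hr.le]
    refine norm_prod_le_iff.2 ⟨hrn.le, ?_⟩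
    refine (pi_norm_le_iff_of_nonneg hr.le).2 fun k => ?_
    rw [norm_mul, hrn, Complex.norm_exp]
    have : (-(s / (r:ℂ)) * (τ k : ℂ)).re = -(s.re / r * τ k) := by
      rw [Complex.re_mul_ofReal, Complex.neg_re, Complex.div_ofReal_re]; ring
    rw [this]
    have hh := hre s hs
    have hk := hτ k
    have : Real.exp (-(s.re / r * τ k)) ≤ 1 := Real.exp_le_one_iff.2 (by
      have : 0 < s.re / r * τ k := by positivity
      linarith)
    nlinarith
  have hf0 : f s0 = 0 := hz
  have hg0 : ‖g s0‖ < ε / 8 := by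
    have := hclose s0 (Metric.mem_closedBall_self hρ0.le)
    rwa [hf0, sub_zero] at this
  have hgs : ∀ z ∈ Metric.sphere s0 ρ, ε / 2 ≤ ‖g z - g s0‖ := by
    intro z hzz
    have h1 := hclose z (Metric.sphere_subset_closedBall hzz)
    have h2 := hmin z hzz
    have h3 : ‖f z‖ ≤ ‖g z - g s0‖ + ‖g z - f z‖ + ‖g s0‖ := by
      have : f z = (g z - g s0) - (g z - f z) + g s0 := by ring
      calc ‖f z‖ = ‖(g z - g s0) - (g z - f z) + g s0‖ := by rw [← this]
        _ ≤ _ := (norm_add_le _ _).trans (add_le_add_left (norm_sub_le _ _) _)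
    linarith
  have hfreq : ∃ᶠ z in nhds s0, g z ≠ g s0 := by
    intro hcon
    have hcon : ∀ᶠ z in nhds s0, g z = g s0 := by
      filter_upwards [hcon] with z hz; simpa using hz
    have hga : AnalyticOnNhd ℂ g Set.univ := hgd.differentiableOn.analyticOnNhd isOpen_univ
    have h0 : g = fun _ => g s0 := hga.eq_of_eventuallyEq analyticOnNhd_const hcon
    obtain ⟨z, hzz⟩ := (NormedSpace.sphere_nonempty (x := s0)).2 hρ0.le
    have := hgs z hzz
    rw [congrFun h0 z] at this
    simp at this; linarith
  have himg := hgd.diffContOnCl.ball_subset_image_closedBall hρ0 hgs hfreq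
  have h0m : (0:ℂ) ∈ Metric.ball (g s0) (ε / 2 / 2) := by
    rw [Metric.mem_ball, dist_zero_left]; linarith
  obtain ⟨s, hs, hgz⟩ := himg h0m
  exact ⟨s, hre s hs, hgz⟩

/-- Proposition 3.2: if the nominal closed loop is exponentially stable and
`B·K_d·C` has an eigenvalue outside `clos(S)`, then the closed loop with the
finite-difference approximation of the derivative is unstable for all
sufficiently small steps `r`. -/
theorem stmt5 {n m p q K : ℕ}
    (hn : 0 < n) (hm : 0 < m) (hp : 0 < p) (hK : 0 < K)
    (A0 : Matrix (Fin n) (Fin n) ℝ) (A : Fin K → Matrix (Fin n) (Fin n) ℝ)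
    (τ : Fin K → ℝ) (hτpos : ∀ k, 0 < τ k) (hτmono : StrictMono τ)
    (B : Matrix (Fin n) (Fin m) ℝ) (hB : B.rank = m)
    (C : Matrix (Fin p) (Fin n) ℝ) (hC : C.rank = p)
    (Kp Kd Ki : Matrix (Fin m) (Fin p) ℝ)
    (Ui : Matrix (Fin m) (Fin q) ℝ) (Vi : Matrix (Fin q) (Fin p) ℝ)
    (hfact : Ki = Ui * Vi) (hUi : Ui.rank = q) (hVi : Vi.rank = q) (hKi : Ki.rank = q)
    (hstab : ∃ δ : ℝ, 0 < δ ∧ ∀ lam : ℂ,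
      H0 A0 A τ B C Kp Kd Ui Vi lam = 0 → lam.re ≤ -δ)
    (heig : ∃ μ : ℂ,
      (μ • (1 : Matrix (Fin n) (Fin n) ℂ) - cM B * cM Kd * cM C).det = 0 ∧
      μ ∉ closure Sset) :
    ∃ rhat : ℝ, 0 < rhat ∧ ∀ r : ℝ, 0 < r → r < rhat →
      ∃ lam : ℂ, 0 < lam.re ∧ H2 A0 A τ B C Kp Kd Ui Vi lam r = 0 := by
  obtain ⟨μ, hμ, hμS⟩ := heig
  obtain ⟨s0, hs0, hse⟩ := exists_s μ hμS
  set D : Matrix (Fin n ⊕ Fin q) (Fin n ⊕ Fin q) ℂ :=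
    Matrix.fromBlocks (cM B * cM Kd * cM C) 0 0 (0 : Matrix (Fin q) (Fin q) ℂ) with hD
  obtain ⟨rhat, hr0, hr⟩ := perturb D
    (Matrix.fromBlocks (cM A0 + cM B * cM Kp * cM C) (cM B * cM Ui) (cM Vi * cM C) 0)
    (fun k => Matrix.fromBlocks (cM (A k)) 0 0 (0 : Matrix (Fin q) (Fin q) ℂ)) τ hτpos s0 hs0 (by
      have : s0 • (1 : Matrix (Fin n ⊕ Fin q) (Fin n ⊕ Fin q) ℂ) - (1 - Complex.exp (-s0)) • D =
          Matrix.fromBlocks ((1 - Complex.exp (-s0)) •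
            (μ • (1 : Matrix (Fin n) (Fin n) ℂ) - cM B * cM Kd * cM C)) 0 0
            (s0 • (1 : Matrix (Fin q) (Fin q) ℂ)) := by
        rw [smul_sub, smul_smul, mul_comm _ μ, ← hse, hD, ← Matrix.fromBlocks_one,
          Matrix.fromBlocks_smul, Matrix.fromBlocks_smul, sub_eq_add_neg, Matrix.fromBlocks_neg,
          Matrix.fromBlocks_add]
        simp [sub_eq_add_neg]
      rw [this, Matrix.det_fromBlocks_zero₂₁, Matrix.det_smul, hμ]
      simp)
  refine ⟨rhat, hr0, fun r h1 h2 => ?_⟩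
  obtain ⟨s, hs, hdet⟩ := hr r h1 h2
  have hrc : (r : ℂ) ≠ 0 := by exact_mod_cast h1.ne'
  have hsc : s ≠ 0 := by rintro rfl; simp at hs
  refine ⟨s / r, by rw [Complex.div_ofReal_re]; positivity, ?_⟩
  unfold H2
  rw [← hD]
  have hsr : s / (r : ℂ) * r = s := by field_simp
  have hsr' : -(s / (r : ℂ)) * r = -s := by field_simp
  refine (mul_eq_zero.1 ((Matrix.det_smul _ (r : ℂ)).symm.trans ?_)).resolve_left
    (pow_ne_zero _ hrc)
  rw [← hdet]
  congr 1
  rw [hsr', hsr, smul_sub, smul_sub, smul_smul, mul_comm (r : ℂ), hsr, smul_sub, smul_smul,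
    Finset.smul_sum]
  congr 2
  · congr 2; field_simp
  · funext k; rw [smul_smul]
end

section
/- (Proposition 4.1, first part.) Assume the nominal closed loop is exponentially stable, i.e. there exists δ > 0 such that every λ ∈ ℂ with H₀(λ) = 0 satisfies Re λ ≤ −δ. If B·K_d·C has a complex eigenvalue with real part strictly larger than 1, then there exists T̂ > 0 such that for every T ∈ (0, T̂) there exists λ ∈ ℂ with Re λ > 0 and H₃(λ; T) = 0; that is, adding the low-pass filter destabilizes the closed loop for all sufficiently small T. -/
open Matrix

/-- The characteristic function `H₃(λ; T)` of the closed loop with a low-pass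
filter `1/(λT+1)` applied to the derivative signal. -/
noncomputable def H3 {n m p q K : ℕ}
    (A0 : Matrix (Fin n) (Fin n) ℝ) (A : Fin K → Matrix (Fin n) (Fin n) ℝ)
    (τ : Fin K → ℝ)
    (B : Matrix (Fin n) (Fin m) ℝ) (C : Matrix (Fin p) (Fin n) ℝ)
    (Kp Kd : Matrix (Fin m) (Fin p) ℝ)
    (Ui : Matrix (Fin m) (Fin q) ℝ) (Vi : Matrix (Fin q) (Fin p) ℝ)
    (lam : ℂ) (T : ℝ) : ℂ :=
  (lam • ((1 : Matrix (Fin n ⊕ Fin q) (Fin n ⊕ Fin q) ℂ)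
      - (1 / (lam * (T : ℂ) + 1)) •
          Matrix.fromBlocks (cM B * cM Kd * cM C) 0 0 (0 : Matrix (Fin q) (Fin q) ℂ))
    - Matrix.fromBlocks (cM A0 + cM B * cM Kp * cM C) (cM B * cM Ui) (cM Vi * cM C) 0
    - ∑ k : Fin K, Complex.exp (-lam * (τ k : ℂ)) •
        Matrix.fromBlocks (cM (A k)) 0 0 (0 : Matrix (Fin q) (Fin q) ℂ)).det

lemma aux_det_diff {ι : Type*} [Fintype ι] [DecidableEq ι] {U : Set ℂ} {M : ℂ → Matrix ι ι ℂ}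
    (h : ∀ i j, DifferentiableOn ℂ (fun s => M s i j) U) :
    DifferentiableOn ℂ (fun s => (M s).det) U := by
  simp only [Matrix.det_apply]
  refine DifferentiableOn.fun_sum fun σ _ => ?_
  refine DifferentiableOn.const_smul ?_ _
  exact DifferentiableOn.fun_finsetProd fun i _ => h _ _

/-- Scaled matrix with perturbation parameters. -/
noncomputable def auxG {n q K : ℕ} (M : Matrix (Fin n) (Fin n) ℂ)
    (N : Matrix (Fin n ⊕ Fin q) (Fin n ⊕ Fin q) ℂ)
    (L : Fin K → Matrix (Fin n ⊕ Fin q) (Fin n ⊕ Fin q) ℂ)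
    (s : ℂ) (X : ℂ × (Fin K → ℂ)) : Matrix (Fin n ⊕ Fin q) (Fin n ⊕ Fin q) ℂ :=
  s • ((1 : Matrix (Fin n ⊕ Fin q) (Fin n ⊕ Fin q) ℂ)
      - (1 / (s + 1)) • Matrix.fromBlocks M 0 0 (0 : Matrix (Fin q) (Fin q) ℂ))
    - X.1 • N - ∑ k, X.2 k • L k

lemma aux_re_ne {s : ℂ} (h : 0 < s.re) : s + 1 ≠ 0 := by
  intro h0
  have := congrArg Complex.re h0
  simp at this
  linarith

lemma aux_zero {n q K : ℕ} (M : Matrix (Fin n) (Fin n) ℂ)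
    (N : Matrix (Fin n ⊕ Fin q) (Fin n ⊕ Fin q) ℂ)
    (L : Fin K → Matrix (Fin n ⊕ Fin q) (Fin n ⊕ Fin q) ℂ) (s : ℂ) (hs : 0 < s.re) :
    (auxG M N L s 0).det = (s / (s + 1)) ^ n * ((s + 1) • (1 : Matrix (Fin n) (Fin n) ℂ) - M).det * s ^ q := by
  have h1 := aux_re_ne hs
  have : auxG M N L s 0 = Matrix.fromBlocks ((s / (s + 1)) • ((s + 1) • (1 : Matrix (Fin n) (Fin n) ℂ) - M)) 0 0
      (s • (1 : Matrix (Fin q) (Fin q) ℂ)) := by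
    unfold auxG
    ext i j
    rcases i with i | i <;> rcases j with j | j <;>
      simp [Matrix.one_apply, mul_sub]
    · have e : s / (s + 1) * (s + 1) = s := by field_simp
      split_ifs <;> simp [e, div_eq_mul_inv, mul_assoc, h1]
  rw [this, Matrix.det_fromBlocks_zero₂₁, Matrix.det_smul, Matrix.det_smul]
  simp

lemma aux_isol {n : ℕ} (M : Matrix (Fin n) (Fin n) ℂ) (s0 : ℂ) :
    ∀ᶠ s in nhdsWithin s0 {s0}ᶜ, ((s + 1) • (1 : Matrix (Fin n) (Fin n) ℂ) - M).det ≠ 0 := by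
  have key : ∀ s : ℂ, ((s + 1) • (1 : Matrix (Fin n) (Fin n) ℂ) - M).det = M.charpoly.eval (s + 1) := by
    intro s
    rw [Matrix.eval_charpoly, Matrix.smul_one_eq_diagonal]
    rfl
  have hfin : {s : ℂ | M.charpoly.eval (s + 1) = 0}.Finite := by
    have h := (Polynomial.finite_setOfPred_isRoot (Matrix.charpoly_monic M).ne_zero)
    exact h.preimage (f := fun s : ℂ => s + 1) (fun a _ b _ h => by simpa using h)
  have h2 : ∀ᶠ s in nhdsWithin s0 {s0}ᶜ, s ∉ {s : ℂ | M.charpoly.eval (s + 1) = 0} \ {s0} := by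
    apply Filter.Eventually.filter_mono nhdsWithin_le_nhds
    exact (hfin.subset Set.sdiff_subset).isClosed.isOpen_compl.mem_nhds (by simp)
  filter_upwards [h2, self_mem_nhdsWithin] with s hs hs0 h0
  rw [key] at h0
  exact hs ⟨h0, hs0⟩

lemma aux_main {n q K : ℕ} (M : Matrix (Fin n) (Fin n) ℂ)
    (N : Matrix (Fin n ⊕ Fin q) (Fin n ⊕ Fin q) ℂ)
    (L : Fin K → Matrix (Fin n ⊕ Fin q) (Fin n ⊕ Fin q) ℂ)
    (τ : Fin K → ℝ) (hτ : ∀ k, 0 < τ k) (s0 : ℂ) (hs0 : 0 < s0.re)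
    (hz : ((s0 + 1) • (1 : Matrix (Fin n) (Fin n) ℂ) - M).det = 0) :
    ∃ δ : ℝ, 0 < δ ∧ ∀ T : ℝ, 0 < T → T < δ → ∃ s : ℂ, 0 < s.re ∧
      (auxG M N L s ((T : ℂ), fun k => (T : ℂ) * Complex.exp (-(s / T) * (τ k : ℂ)))).det = 0 := by
  obtain ⟨r0, hr0, hb⟩ := Metric.eventually_nhds_iff.1 (eventually_nhdsWithin_iff.1 (aux_isol M s0))
  obtain ⟨r, hr, hrr0, hrs⟩ : ∃ r : ℝ, 0 < r ∧ r < r0 ∧ r < s0.re :=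
    ⟨min r0 s0.re / 2, by positivity, by linarith [min_le_left r0 s0.re, lt_min hr0 hs0],
      by linarith [min_le_right r0 s0.re, lt_min hr0 hs0]⟩
  have hcb : ∀ s ∈ Metric.closedBall s0 r, 0 < s.re := by
    intro s hs
    have h1 : |(s - s0).re| ≤ r := (Complex.abs_re_le_norm _).trans (by simpa [dist_eq_norm] using hs)
    have := (abs_le.1 h1).1
    simp at this
    linarith
  have hcont : ∀ s : ℂ, 0 < s.re → ∀ X, ContinuousAt (fun p : ℂ × (ℂ × (Fin K → ℂ)) => (auxG M N L p.1 p.2).det) (s, X) := by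
    intro s hs X
    have h1 := aux_re_ne hs
    have h2 : ContinuousAt (fun p : ℂ × (ℂ × (Fin K → ℂ)) => 1 / (p.1 + 1)) (s, X) := by
      refine ContinuousAt.div (f := fun _ => (1:ℂ)) (g := fun p : ℂ × (ℂ × (Fin K → ℂ)) => p.1 + 1) ?_ ?_ h1 <;> fun_prop
    have h3 : ContinuousAt (fun p : ℂ × (ℂ × (Fin K → ℂ)) => auxG M N L p.1 p.2) (s, X) := by
      unfold auxG
      fun_prop
    exact ContinuousAt.comp (g := fun A : Matrix (Fin n ⊕ Fin q) (Fin n ⊕ Fin q) ℂ => A.det)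
      (Continuous.matrix_det continuous_id).continuousAt h3
  have hcont0 : ∀ s : ℂ, 0 < s.re → ContinuousAt (fun s => (auxG M N L s 0).det) s := by
    intro s hs
    exact ContinuousAt.comp (f := fun s : ℂ => (s, (0 : ℂ × (Fin K → ℂ)))) (hcont s hs 0) (by fun_prop)
  have hz0 : (auxG M N L s0 0).det = 0 := by
    rw [aux_zero _ _ _ _ hs0, hz]; simp
  obtain ⟨ε, hε, hlow⟩ : ∃ ε : ℝ, 0 < ε ∧ ∀ s ∈ Metric.sphere s0 r, ε ≤ ‖(auxG M N L s 0).det‖ := by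
    have hc : IsCompact (Metric.sphere s0 r) := isCompact_sphere _ _
    have hne : (Metric.sphere s0 r).Nonempty := NormedSpace.sphere_nonempty.2 hr.le
    obtain ⟨x, hx, hmin⟩ := hc.exists_isMinOn hne (f := fun s => ‖(auxG M N L s 0).det‖)
      (fun s hs => ((hcont0 s (hcb s (Metric.sphere_subset_closedBall hs))).norm).continuousWithinAt)
    refine ⟨_, ?_, fun s hs => hmin hs⟩
    have hxre := hcb x (Metric.sphere_subset_closedBall hx)
    have hx0 : x ≠ 0 := by rintro rfl; simp at hxre
    have hxs : x ≠ s0 := Metric.ne_of_mem_sphere hx hr.ne'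
    have hd := hb (y := x) (by rw [Metric.mem_sphere.1 hx]; exact hrr0) hxs
    rw [norm_pos_iff, aux_zero _ _ _ _ hxre]
    have := aux_re_ne hxre
    positivity
  have hev : ∀ᶠ X in nhds (0 : ℂ × (Fin K → ℂ)), ∀ s ∈ Metric.closedBall s0 r,
      ‖(auxG M N L s X).det - (auxG M N L s 0).det‖ < ε / 4 := by
    apply (isCompact_closedBall s0 r).eventually_forall_of_forall_eventually
    intro s hs
    have hre := hcb s hs
    have h1 : ContinuousAt (fun z : ℂ × (ℂ × (Fin K → ℂ)) =>
      ‖(auxG M N L z.1 z.2).det - (auxG M N L z.1 0).det‖) (s, 0) :=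
      ((hcont s hre 0).sub (ContinuousAt.comp (f := Prod.fst) (x := (s, (0 : ℂ × (Fin K → ℂ)))) (hcont0 s hre) continuousAt_fst)).norm
    have h2 : ∀ᶠ z in nhds (s, (0 : ℂ × (Fin K → ℂ))),
        ‖(auxG M N L z.1 z.2).det - (auxG M N L z.1 0).det‖ < ε / 4 :=
      h1.eventually_lt continuousAt_const (by simp only [sub_self, norm_zero]; positivity)
    exact (continuous_swap.tendsto ((0 : ℂ × (Fin K → ℂ)), s)).eventually h2
  obtain ⟨δ, hδ, hball⟩ := Metric.eventually_nhds_iff.1 hev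
  refine ⟨δ, hδ, fun T hT hTδ => ?_⟩
  set F : ℂ → ℂ := fun s =>
    (auxG M N L s ((T : ℂ), fun k => (T : ℂ) * Complex.exp (-(s / T) * (τ k : ℂ)))).det with hF
  have hclose : ∀ s ∈ Metric.closedBall s0 r, ‖F s - (auxG M N L s 0).det‖ < ε / 4 := by
    intro s hs
    have hre := hcb s hs
    refine hball ?_ s hs
    rw [dist_zero_right]
    refine lt_of_le_of_lt ?_ hTδ
    refine max_le (by simp [abs_of_pos hT]) ?_
    refine (pi_norm_le_iff_of_nonneg hT.le).2 fun k => ?_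
    rw [norm_mul, Complex.norm_exp]
    have : (-(s / T) * (τ k : ℂ)).re ≤ 0 := by
      have e : (-(s / T) * (τ k : ℂ)).re = -(s.re / T * τ k) := by
        rw [Complex.re_mul_ofReal, Complex.neg_re, Complex.div_ofReal_re]; ring
      rw [e]
      have := hτ k
      have : 0 < s.re / T * τ k := by positivity
      linarith
    have h2 := Real.exp_le_one_iff.2 this
    simp only [Complex.norm_real, Real.norm_eq_abs, abs_of_pos hT]
    nlinarith
  have hdiff : DifferentiableOn ℂ F {s : ℂ | 0 < s.re} := by
    apply aux_det_diff
    intro i j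
    simp only [auxG, Matrix.sub_apply, Matrix.smul_apply, Matrix.sum_apply, smul_eq_mul]
    have h2 : DifferentiableOn ℂ (fun s : ℂ => 1 / (s + 1)) {s : ℂ | 0 < s.re} :=
      DifferentiableOn.div (by fun_prop) (by fun_prop) (fun s hs => aux_re_ne hs)
    fun_prop
  have hopen : IsOpen {s : ℂ | 0 < s.re} := isOpen_lt continuous_const Complex.continuous_re
  have hs0F : ‖F s0‖ < ε / 4 := by
    have := hclose s0 (Metric.mem_closedBall_self hr.le)
    rwa [hz0, sub_zero] at this
  have hsph : ∀ s ∈ Metric.sphere s0 r, ε / 2 ≤ ‖F s - F s0‖ := by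
    intro s hs
    have h1 := hlow s hs
    have h2 := hclose s (Metric.sphere_subset_closedBall hs)
    have h3 : ‖(auxG M N L s 0).det‖ ≤ ‖F s - F s0‖ + ‖F s0‖ + ‖F s - (auxG M N L s 0).det‖ := by
      have e : (auxG M N L s 0).det = (F s - F s0) + F s0 - (F s - (auxG M N L s 0).det) := by ring
      calc _ = ‖(F s - F s0) + F s0 - (F s - (auxG M N L s 0).det)‖ := by rw [← e]
        _ ≤ _ := (norm_sub_le _ _).trans (by gcongr; exact norm_add_le _ _)
    linarith
  have hfreq : ∃ᶠ z in nhds s0, F z ≠ F s0 := by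
    intro hcon
    have hcon' : F =ᶠ[nhds s0] fun _ => F s0 := by
      filter_upwards [hcon] with z hz
      simpa using hz
    have heq := (hdiff.analyticOnNhd hopen).eqOn_of_preconnected_of_eventuallyEq
      (analyticOnNhd_const) (convex_halfSpace_re_gt 0).isPreconnected hs0 hcon'
    obtain ⟨x, hx⟩ := (NormedSpace.sphere_nonempty (x := s0)).2 hr.le
    have h1 := hsph x hx
    have h2 := heq (hcb x (Metric.sphere_subset_closedBall hx))
    simp only at h2
    rw [h2, sub_self, norm_zero] at h1
    linarith
  have hdc : DiffContOnCl ℂ F (Metric.ball s0 r) := by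
    apply DifferentiableOn.diffContOnCl
    rw [closure_ball _ hr.ne']
    exact hdiff.mono hcb
  have := hdc.ball_subset_image_closedBall hr hsph hfreq
  obtain ⟨s, hs, hsF⟩ := this (show (0 : ℂ) ∈ _ by
    rw [Metric.mem_ball, dist_zero_left]; linarith)
  exact ⟨s, hcb s hs, hsF⟩

/-- Proposition 4.1, first part: if the nominal closed loop is exponentially stable
and `B·K_d·C` has an eigenvalue with real part `> 1`, then the low-pass filter
destabilizes the closed loop for all sufficiently small time constants `T`. -/
theorem stmt6 {n m p q K : ℕ}
    (hn : 0 < n) (hm : 0 < m) (hp : 0 < p) (hK : 0 < K)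
    (A0 : Matrix (Fin n) (Fin n) ℝ) (A : Fin K → Matrix (Fin n) (Fin n) ℝ)
    (τ : Fin K → ℝ) (hτpos : ∀ k, 0 < τ k) (hτmono : StrictMono τ)
    (B : Matrix (Fin n) (Fin m) ℝ) (hB : B.rank = m)
    (C : Matrix (Fin p) (Fin n) ℝ) (hC : C.rank = p)
    (Kp Kd Ki : Matrix (Fin m) (Fin p) ℝ)
    (Ui : Matrix (Fin m) (Fin q) ℝ) (Vi : Matrix (Fin q) (Fin p) ℝ)
    (hfact : Ki = Ui * Vi) (hUi : Ui.rank = q) (hVi : Vi.rank = q) (hKi : Ki.rank = q)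
    (hstab : ∃ δ : ℝ, 0 < δ ∧ ∀ lam : ℂ,
      H0 A0 A τ B C Kp Kd Ui Vi lam = 0 → lam.re ≤ -δ)
    (heig : ∃ μ : ℂ,
      (μ • (1 : Matrix (Fin n) (Fin n) ℂ) - cM B * cM Kd * cM C).det = 0 ∧
      1 < μ.re) :
    ∃ That : ℝ, 0 < That ∧ ∀ T : ℝ, 0 < T → T < That →
      ∃ lam : ℂ, 0 < lam.re ∧ H3 A0 A τ B C Kp Kd Ui Vi lam T = 0 := by
  obtain ⟨μ, hμ, hμ1⟩ := heig
  obtain ⟨δ, hδ, h⟩ := aux_main (cM B * cM Kd * cM C)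
    (Matrix.fromBlocks (cM A0 + cM B * cM Kp * cM C) (cM B * cM Ui) (cM Vi * cM C) 0)
    (fun k => Matrix.fromBlocks (cM (A k)) 0 0 (0 : Matrix (Fin q) (Fin q) ℂ)) τ hτpos (μ - 1)
    (by simpa using hμ1) (by simpa using hμ)
  refine ⟨δ, hδ, fun T hT hTδ => ?_⟩
  obtain ⟨s, hs, hz⟩ := h T hT hTδ
  have hT0 : (T : ℂ) ≠ 0 := by exact_mod_cast hT.ne'
  refine ⟨s / T, by rw [Complex.div_ofReal_re]; positivity, ?_⟩
  unfold auxG at hz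
  unfold H3
  rw [div_mul_cancel₀ s hT0]
  have hmul : ∀ Z : Matrix (Fin n ⊕ Fin q) (Fin n ⊕ Fin q) ℂ, ((T : ℂ) • Z).det = 0 → Z.det = 0 := by
    intro Z hZ
    rw [Matrix.det_smul] at hZ
    exact (mul_eq_zero.1 hZ).resolve_left (pow_ne_zero _ hT0)
  apply hmul
  rw [← hz]
  congr 1
  rw [smul_sub, smul_sub, smul_smul, mul_div_cancel₀ s hT0, Finset.smul_sum]
  simp only [smul_smul]
end

section
/- (Proposition 4.1, second part.) Assume the nominal closed loop is exponentially stable, i.e. there exists δ > 0 such that every λ ∈ ℂ with H₀(λ) = 0 satisfies Re λ ≤ −δ. If every complex eigenvalue of B·K_d·C has real part strictly smaller than 1 (i.e. B·K_d·C − Iₙ is Hurwitz), then there exists T̂ > 0 such that for every T ∈ (0, T̂) there exists c > 0 with the property that every λ ∈ ℂ with Re λ > −c satisfies H₃(λ; T) ≠ 0; that is, the closed loop with low-pass filter is exponentially stable for all sufficiently small T. -/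
open Matrix

lemma aux_small {ι : Type*} [Fintype ι] [DecidableEq ι] {K : ℕ} (E M P : Matrix ι ι ℂ)
    (Q : Fin K → Matrix ι ι ℂ) (τ : Fin K → ℝ) (U : Filter ℕ) [U.NeBot]
    (l : ℕ → ℂ) (T : ℕ → ℝ) (l0 : ℂ)
    (hl : Filter.Tendsto l U (nhds l0)) (hT : Filter.Tendsto T U (nhds 0))
    (h : ∀ j, (l j • (E - (1 / (l j * (T j : ℂ) + 1)) • M) - P
      - ∑ k, Complex.exp (-l j * (τ k : ℂ)) • Q k).det = 0) :
    (l0 • (E - M) - P - ∑ k, Complex.exp (-l0 * (τ k : ℂ)) • Q k).det = 0 := by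
  have hTc : Filter.Tendsto (fun j => (T j : ℂ)) U (nhds 0) := by
    simpa [Function.comp_def] using (Complex.continuous_ofReal.tendsto 0).comp hT
  have hz : Filter.Tendsto (fun j => 1 / (l j * (T j : ℂ) + 1)) U (nhds 1) := by
    have h1 : Filter.Tendsto (fun j => l j * (T j : ℂ) + 1) U (nhds 1) := by
      simpa using (hl.mul hTc).add_const 1
    simpa using h1.inv₀ one_ne_zero
  have hm : Filter.Tendsto (fun j => (l j • (E - (1 / (l j * (T j : ℂ) + 1)) • M) - P
      - ∑ k, Complex.exp (-l j * (τ k : ℂ)) • Q k)) U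
      (nhds (l0 • (E - (1 : ℂ) • M) - P - ∑ k, Complex.exp (-l0 * (τ k : ℂ)) • Q k)) := by
    refine ((hl.smul (tendsto_const_nhds.sub (hz.smul tendsto_const_nhds))).sub
      tendsto_const_nhds).sub (tendsto_finsetSum _ fun k _ => ?_)
    exact ((Complex.continuous_exp.tendsto _).comp
      (hl.neg.mul tendsto_const_nhds)).smul tendsto_const_nhds
  have hd := ((continuous_id.matrix_det).tendsto _).comp hm
  have h2 := tendsto_nhds_unique hd
    ((tendsto_const_nhds (x := (0 : ℂ))).congr fun j => (h j).symm)
  simpa using h2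

lemma aux_big {ι : Type*} [Fintype ι] [DecidableEq ι] {K : ℕ} (M P : Matrix ι ι ℂ)
    (Q : Fin K → Matrix ι ι ℂ) (τ : Fin K → ℝ) (hτ : ∀ k, 0 < τ k) (U : Ultrafilter ℕ)
    (l : ℕ → ℂ) (T : ℕ → ℝ) (c : ℝ) (hc : 0 < c) (hT0 : ∀ j, 0 < T j)
    (hre : ∀ j, -c < (l j).re)
    (hl : Filter.Tendsto (fun j => ‖l j‖) U Filter.atTop)
    (hT : Filter.Tendsto T U (nhds 0))
    (h : ∀ j, (l j • ((1 : Matrix ι ι ℂ) - (1 / (l j * (T j : ℂ) + 1)) • M) - P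
      - ∑ k, Complex.exp (-l j * (τ k : ℂ)) • Q k).det = 0) :
    ∃ w : ℂ, 1 ≤ w.re ∧ (w • (1 : Matrix ι ι ℂ) - M).det = 0 := by
  have hs : Filter.Tendsto (fun j => (l j)⁻¹) U (nhds 0) :=
    Filter.tendsto_inv₀_cobounded.comp (tendsto_norm_atTop_iff_cobounded.1 hl)
  have hne : ∀ᶠ j in (U : Filter ℕ), l j ≠ 0 := by
    filter_upwards [hl.eventually_gt_atTop 0] with j hj
    exact norm_pos_iff.1 hj
  have hwre : ∀ j, 1 - c * T j ≤ (l j * (T j : ℂ) + 1).re := by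
    intro j
    have := mul_le_mul_of_nonneg_right (hre j).le (hT0 j).le
    simp
    linarith
  have hlow : Filter.Tendsto (fun j => 1 - c * T j) U (nhds 1) := by
    simpa using (tendsto_const_nhds (x := (1 : ℝ))).sub (hT.const_mul c)
  have hbd : ∀ᶠ j in (U : Filter ℕ), 1 / (l j * (T j : ℂ) + 1) ∈ Metric.closedBall (0 : ℂ) 2 := by
    filter_upwards [hlow.eventually (lt_mem_nhds (show (1 / 2 : ℝ) < 1 by norm_num))] with j hj
    have h1 : (1 / 2 : ℝ) ≤ ‖l j * (T j : ℂ) + 1‖ :=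
      (hj.le.trans (hwre j)).trans (Complex.re_le_norm _)
    rw [mem_closedBall_zero_iff, norm_div, norm_one, div_le_iff₀ (by linarith)]
    linarith
  obtain ⟨z, -, hz⟩ := (isCompact_closedBall (0 : ℂ) 2).ultrafilter_le_nhds
    (U.map fun j => 1 / (l j * (T j : ℂ) + 1)) (by
      rw [Filter.le_principal_iff]; exact hbd)
  replace hz : Filter.Tendsto (fun j => 1 / (l j * (T j : ℂ) + 1)) U (nhds z) := hz
  have hse : ∀ k, Filter.Tendsto (fun j => (l j)⁻¹ * Complex.exp (-l j * (τ k : ℂ))) U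
      (nhds 0) := by
    intro k
    refine squeeze_zero_norm (a := fun j => ‖(l j)⁻¹‖ * Real.exp (c * τ k)) (fun j => ?_) ?_
    · rw [norm_mul, Complex.norm_exp]
      gcongr
      have := mul_le_mul_of_nonneg_right (hre j).le (hτ k).le
      simp
      linarith
    · simpa using hs.norm.mul_const (Real.exp (c * τ k))
  have hm : Filter.Tendsto (fun j => ((1 : Matrix ι ι ℂ) - (1 / (l j * (T j : ℂ) + 1)) • M)
      - (l j)⁻¹ • P - ∑ k, ((l j)⁻¹ * Complex.exp (-l j * (τ k : ℂ))) • Q k) U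
      (nhds ((1 - z • M) - (0 : ℂ) • P - ∑ k, (0 : ℂ) • Q k)) := by
    refine ((tendsto_const_nhds.sub (hz.smul tendsto_const_nhds)).sub
      (hs.smul tendsto_const_nhds)).sub (tendsto_finsetSum _ fun k _ => ?_)
    exact (hse k).smul tendsto_const_nhds
  have hd := ((continuous_id.matrix_det).tendsto _).comp hm
  have h2 := tendsto_nhds_unique hd
    ((tendsto_const_nhds (x := (0 : ℂ))).congr' (by
      filter_upwards [hne] with j hj
      have h3 : ((1 : Matrix ι ι ℂ) - (1 / (l j * (T j : ℂ) + 1)) • M)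
          - (l j)⁻¹ • P - ∑ k, ((l j)⁻¹ * Complex.exp (-l j * (τ k : ℂ))) • Q k
          = (l j)⁻¹ • (l j • ((1 : Matrix ι ι ℂ) - (1 / (l j * (T j : ℂ) + 1)) • M) - P
            - ∑ k, Complex.exp (-l j * (τ k : ℂ)) • Q k) := by
        rw [smul_sub, smul_sub, inv_smul_smul₀ hj, Finset.smul_sum]
        simp only [smul_smul]
      simp only [Function.comp, id]
      rw [h3, Matrix.det_smul, h j, mul_zero]))
  have h4 : (1 - z • M).det = 0 := by simpa using h2
  have hz0 : z ≠ 0 := by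
    rintro rfl
    simp at h4
  refine ⟨z⁻¹, ?_, ?_⟩
  · have h5 : Filter.Tendsto (fun j => (l j * (T j : ℂ) + 1).re) U (nhds (z⁻¹).re) := by
      have := (Complex.continuous_re.tendsto _).comp (hz.inv₀ hz0)
      simpa [Function.comp_def] using this
    exact le_of_tendsto_of_tendsto' hlow h5 hwre
  · have : z⁻¹ • (1 : Matrix ι ι ℂ) - M = z⁻¹ • (1 - z • M) := by
      rw [smul_sub, inv_smul_smul₀ hz0]
    rw [this, Matrix.det_smul, h4, mul_zero]

/-- Proposition 4.1, second part: if the nominal closed loop is exponentially stable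
and every eigenvalue of `B·K_d·C` has real part `< 1` (i.e. `B·K_d·C − Iₙ` is
Hurwitz), then the closed loop with low-pass filter is exponentially stable for
all sufficiently small time constants `T`. -/
theorem stmt7 {n m p q K : ℕ}
    (hn : 0 < n) (hm : 0 < m) (hp : 0 < p) (hK : 0 < K)
    (A0 : Matrix (Fin n) (Fin n) ℝ) (A : Fin K → Matrix (Fin n) (Fin n) ℝ)
    (τ : Fin K → ℝ) (hτpos : ∀ k, 0 < τ k) (hτmono : StrictMono τ)
    (B : Matrix (Fin n) (Fin m) ℝ) (hB : B.rank = m)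
    (C : Matrix (Fin p) (Fin n) ℝ) (hC : C.rank = p)
    (Kp Kd Ki : Matrix (Fin m) (Fin p) ℝ)
    (Ui : Matrix (Fin m) (Fin q) ℝ) (Vi : Matrix (Fin q) (Fin p) ℝ)
    (hfact : Ki = Ui * Vi) (hUi : Ui.rank = q) (hVi : Vi.rank = q) (hKi : Ki.rank = q)
    (hstab : ∃ δ : ℝ, 0 < δ ∧ ∀ lam : ℂ,
      H0 A0 A τ B C Kp Kd Ui Vi lam = 0 → lam.re ≤ -δ)
    (hHurwitz : ∀ μ : ℂ,
      (μ • (1 : Matrix (Fin n) (Fin n) ℂ) - cM B * cM Kd * cM C).det = 0 → μ.re < 1) :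
    ∃ That : ℝ, 0 < That ∧ ∀ T : ℝ, 0 < T → T < That →
      ∃ c : ℝ, 0 < c ∧ ∀ lam : ℂ, -c < lam.re →
        H3 A0 A τ B C Kp Kd Ui Vi lam T ≠ 0 := by
  obtain ⟨δ, hδ, hst⟩ := hstab
  by_contra hcon
  push Not at hcon
  have hseq : ∀ j : ℕ, ∃ T : ℝ, ∃ lam : ℂ, 0 < T ∧ T < 1 / ((j : ℝ) + 1) ∧ -(δ / 2) < lam.re ∧
      H3 A0 A τ B C Kp Kd Ui Vi lam T = 0 := by
    intro j
    obtain ⟨T, hT, hT', h⟩ := hcon (1 / ((j : ℝ) + 1)) (by positivity)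
    obtain ⟨lam, h1, h2⟩ := h (δ / 2) (by positivity)
    exact ⟨T, lam, hT, hT', h1, h2⟩
  choose T l hT0 hT1 hre hH using hseq
  have hT : Filter.Tendsto T Filter.atTop (nhds 0) :=
    squeeze_zero (fun j => (hT0 j).le) (fun j => (hT1 j).le) tendsto_one_div_add_atTop_nhds_zero_nat
  let U : Ultrafilter ℕ := Ultrafilter.of Filter.atTop
  have hTU : Filter.Tendsto T U (nhds 0) := hT.mono_left (Ultrafilter.of_le _)
  by_cases hb : ∃ R : ℝ, ∀ᶠ j in (U : Filter ℕ), ‖l j‖ ≤ R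
  · obtain ⟨R, hR⟩ := hb
    obtain ⟨l0, -, hl⟩ := (isCompact_closedBall (0 : ℂ) R).ultrafilter_le_nhds (U.map l) (by
      rw [Filter.le_principal_iff]
      change ∀ᶠ j in (U : Filter ℕ), l j ∈ Metric.closedBall (0 : ℂ) R
      simpa using hR)
    replace hl : Filter.Tendsto l U (nhds l0) := hl
    have h0 := aux_small 1 _ _ _ τ U l T l0 hl hTU hH
    have h1 : H0 A0 A τ B C Kp Kd Ui Vi l0 = 0 := by
      rw [← h0, H0]
      congr 4
      simp only [← Matrix.fromBlocks_one, sub_eq_add_neg, Matrix.fromBlocks_neg,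
        Matrix.fromBlocks_add, neg_zero, add_zero]
    have h2 := hst l0 h1
    have h3 : -(δ / 2) ≤ l0.re :=
      ge_of_tendsto' ((Complex.continuous_re.tendsto _).comp hl) fun j => (hre j).le
    linarith
  · push Not at hb
    have hl : Filter.Tendsto (fun j => ‖l j‖) U Filter.atTop := by
      refine Filter.tendsto_atTop.2 fun R => ?_
      have := hb R
      filter_upwards [this] with j hj using hj.le
    obtain ⟨w, hw, hdet⟩ := aux_big _ _ _ τ hτpos U l T (δ / 2) (by positivity) hT0 hre hl hTU hH
    have h1 : (w • (1 : Matrix (Fin n) (Fin n) ℂ) - cM B * cM Kd * cM C).det = 0 := by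
      have h2 : w • (1 : Matrix (Fin n ⊕ Fin q) (Fin n ⊕ Fin q) ℂ)
          - Matrix.fromBlocks (cM B * cM Kd * cM C) 0 0 (0 : Matrix (Fin q) (Fin q) ℂ)
          = Matrix.fromBlocks (w • (1 : Matrix (Fin n) (Fin n) ℂ) - cM B * cM Kd * cM C) 0 0
            (w • (1 : Matrix (Fin q) (Fin q) ℂ)) := by
        rw [← Matrix.fromBlocks_one, Matrix.fromBlocks_smul, sub_eq_add_neg, Matrix.fromBlocks_neg, Matrix.fromBlocks_add]
        simp [sub_eq_add_neg]
      rw [h2, Matrix.det_fromBlocks_zero₂₁, Matrix.det_smul, Matrix.det_one, mul_one] at hdet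
      rcases mul_eq_zero.1 hdet with h | h
      · exact h
      · have hw0 : w ≠ 0 := by
          rintro rfl
          simp at hw
          linarith
        exact absurd h (pow_ne_zero _ hw0)
    linarith [hHurwitz w h1]
end

section
/- (Proposition 4.2.) Assume the nominal closed loop is exponentially stable, i.e. there exists δ > 0 such that every λ ∈ ℂ with H₀(λ) = 0 satisfies Re λ ≤ −δ, and assume that every complex eigenvalue of B·K_d·C has real part strictly smaller than 1 (B·K_d·C − Iₙ is Hurwitz). Then there exists T̂ > 0 such that for every T ∈ (0, T̂) and every perturbation triple (R₁, R₂, R₃) there exist r̂ > 0 and c > 0 such that for all r₁, r₂, r₃ ∈ (0, r̂), every λ ∈ ℂ with Re λ > −c satisfies H₄(λ; T, r₁, r₂, r₃) ≠ 0; that is, the closed loop with low-pass filter is strongly stable for sufficiently small T. -/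
open Matrix

attribute [local instance] Matrix.normedAddCommGroup

/-- An admissible perturbation family of size `s`: for each perturbation
parameter `r ≥ 0`, a matrix-valued function of `λ` that is entrywise meromorphic
in `λ`, continuous in `r`, equal to the identity at `r = 0`, converging to the
identity uniformly on compact sets as `r → 0+`, and uniformly bounded on a right
half-plane for small `r`. -/
structure Admissible (s : ℕ) (R : ℂ → ℝ → Matrix (Fin s) (Fin s) ℂ) : Prop where
  merom : ∀ r : ℝ, 0 ≤ r → ∀ i j : Fin s, MeromorphicOn (fun lam => R lam r i j) Set.univ
  cont : ∀ (lam : ℂ) (i j : Fin s), ContinuousOn (fun r => R lam r i j) (Set.Ici 0)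
  id_at_zero : ∀ lam : ℂ, R lam 0 = 1
  unif_conv : ∀ Ω : Set ℂ, IsCompact Ω → ∀ ε : ℝ, 0 < ε → ∃ δ : ℝ, 0 < δ ∧
    ∀ r : ℝ, 0 < r → r < δ → ∀ lam ∈ Ω, ‖R lam r - 1‖ ≤ ε
  bounded : ∃ M N rbar : ℝ, 0 < M ∧ 0 < N ∧ 0 < rbar ∧
    ∀ lam : ℂ, -N ≤ lam.re → ∀ r : ℝ, 0 < r → r < rbar → ‖R lam r‖ ≤ M

/-- The perturbed low-pass-filtered characteristic function `H₄(λ; T, r₁, r₂, r₃)`. -/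
noncomputable def H4 {n m p q K : ℕ}
    (A0 : Matrix (Fin n) (Fin n) ℝ) (A : Fin K → Matrix (Fin n) (Fin n) ℝ)
    (τ : Fin K → ℝ)
    (B : Matrix (Fin n) (Fin m) ℝ) (C : Matrix (Fin p) (Fin n) ℝ)
    (Kp Kd : Matrix (Fin m) (Fin p) ℝ)
    (Ui : Matrix (Fin m) (Fin q) ℝ) (Vi : Matrix (Fin q) (Fin p) ℝ)
    (R1 : ℂ → ℝ → Matrix (Fin m) (Fin m) ℂ)
    (R2 R3 : ℂ → ℝ → Matrix (Fin p) (Fin p) ℂ)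
    (lam : ℂ) (T r1 r2 r3 : ℝ) : ℂ :=
  (lam • (1 : Matrix (Fin n ⊕ Fin q) (Fin n ⊕ Fin q) ℂ)
    - Matrix.fromBlocks (cM A0) 0 0 (0 : Matrix (Fin q) (Fin q) ℂ)
    - ∑ k : Fin K, Complex.exp (-lam * (τ k : ℂ)) •
        Matrix.fromBlocks (cM (A k)) 0 0 (0 : Matrix (Fin q) (Fin q) ℂ)
    - Matrix.fromBlocks (cM B * R1 lam r1) 0 0 (1 : Matrix (Fin q) (Fin q) ℂ)
      * Matrix.fromBlocks
          (cM Kp + (lam / (lam * (T : ℂ) + 1)) • (cM Kd * R2 lam r2))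
          (cM Ui) (cM Vi) (0 : Matrix (Fin q) (Fin q) ℂ)
      * Matrix.fromBlocks (R3 lam r3 * cM C) 0 0 (1 : Matrix (Fin q) (Fin q) ℂ)).det

/-- Homogenised characteristic function. -/
noncomputable def GG {n m p q K : ℕ}
    (A0 : Matrix (Fin n) (Fin n) ℂ) (A : Fin K → Matrix (Fin n) (Fin n) ℂ)
    (B : Matrix (Fin n) (Fin m) ℂ) (C : Matrix (Fin p) (Fin n) ℂ)
    (Kp Kd : Matrix (Fin m) (Fin p) ℂ)
    (Ui : Matrix (Fin m) (Fin q) ℂ) (Vi : Matrix (Fin q) (Fin p) ℂ)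
    (σ s h : ℂ) (e : Fin K → ℂ)
    (R1 : Matrix (Fin m) (Fin m) ℂ) (R2 R3 : Matrix (Fin p) (Fin p) ℂ) :
    Matrix (Fin n ⊕ Fin q) (Fin n ⊕ Fin q) ℂ :=
  Matrix.fromBlocks
    (σ • 1 - s • A0 - ∑ k, (s * e k) • A k - B * R1 * (s • Kp + h • (Kd * R2)) * (R3 * C))
    (-(s • (B * R1 * Ui))) (-(s • (Vi * (R3 * C)))) (σ • 1)

lemma sum_fromBlocks_aux {n q K : ℕ} (c : Fin K → ℂ) (A : Fin K → Matrix (Fin n) (Fin n) ℂ)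
    (S : Finset (Fin K)) :
    ∑ k ∈ S, c k • Matrix.fromBlocks (A k) 0 0 (0 : Matrix (Fin q) (Fin q) ℂ)
      = Matrix.fromBlocks (∑ k ∈ S, c k • A k) 0 0 0 := by
  classical
  induction S using Finset.induction_on with
  | empty => simp
  | insert a S ha ih =>
    rw [Finset.sum_insert ha, Finset.sum_insert ha, ih, Matrix.fromBlocks_smul,
      Matrix.fromBlocks_add]
    simp

lemma H4_eq {n m p q K : ℕ}
    (A0 : Matrix (Fin n) (Fin n) ℝ) (A : Fin K → Matrix (Fin n) (Fin n) ℝ)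
    (τ : Fin K → ℝ)
    (B : Matrix (Fin n) (Fin m) ℝ) (C : Matrix (Fin p) (Fin n) ℝ)
    (Kp Kd : Matrix (Fin m) (Fin p) ℝ)
    (Ui : Matrix (Fin m) (Fin q) ℝ) (Vi : Matrix (Fin q) (Fin p) ℝ)
    (R1 : ℂ → ℝ → Matrix (Fin m) (Fin m) ℂ)
    (R2 R3 : ℂ → ℝ → Matrix (Fin p) (Fin p) ℂ)
    (lam : ℂ) (T r1 r2 r3 : ℝ) :
    H4 A0 A τ B C Kp Kd Ui Vi R1 R2 R3 lam T r1 r2 r3 =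
    (GG (cM A0) (fun k => cM (A k)) (cM B) (cM C) (cM Kp) (cM Kd) (cM Ui) (cM Vi)
      lam 1 (lam / (lam * (T : ℂ) + 1)) (fun k => Complex.exp (-lam * (τ k : ℂ)))
      (R1 lam r1) (R2 lam r2) (R3 lam r3)).det := by
  unfold H4 GG
  congr 1
  rw [sum_fromBlocks_aux, ← Matrix.fromBlocks_one, Matrix.fromBlocks_smul,
    Matrix.fromBlocks_multiply, Matrix.fromBlocks_multiply]
  simp only [sub_eq_add_neg, Matrix.fromBlocks_neg, Matrix.fromBlocks_add]
  simp [Matrix.mul_assoc]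

lemma H0_eq {n m p q K : ℕ}
    (A0 : Matrix (Fin n) (Fin n) ℝ) (A : Fin K → Matrix (Fin n) (Fin n) ℝ)
    (τ : Fin K → ℝ)
    (B : Matrix (Fin n) (Fin m) ℝ) (C : Matrix (Fin p) (Fin n) ℝ)
    (Kp Kd : Matrix (Fin m) (Fin p) ℝ)
    (Ui : Matrix (Fin m) (Fin q) ℝ) (Vi : Matrix (Fin q) (Fin p) ℝ)
    (lam : ℂ) :
    H0 A0 A τ B C Kp Kd Ui Vi lam =
    (GG (cM A0) (fun k => cM (A k)) (cM B) (cM C) (cM Kp) (cM Kd) (cM Ui) (cM Vi)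
      lam 1 lam (fun k => Complex.exp (-lam * (τ k : ℂ))) 1 1 1).det := by
  unfold H0 GG
  congr 1
  rw [sum_fromBlocks_aux, Matrix.fromBlocks_smul]
  simp only [sub_eq_add_neg, Matrix.fromBlocks_neg, Matrix.fromBlocks_add]
  congr 1
  · simp [Matrix.mul_assoc, Matrix.mul_add, Matrix.add_mul]
    abel
  · simp
  · simp
  · simp

section
variable {n m p q K : ℕ}
    (A0 : Matrix (Fin n) (Fin n) ℂ) (A : Fin K → Matrix (Fin n) (Fin n) ℂ)
    (B : Matrix (Fin n) (Fin m) ℂ) (C : Matrix (Fin p) (Fin n) ℂ)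
    (Kp Kd : Matrix (Fin m) (Fin p) ℂ)
    (Ui : Matrix (Fin m) (Fin q) ℂ) (Vi : Matrix (Fin q) (Fin p) ℂ)

lemma GG_smul (c σ s h : ℂ) (e : Fin K → ℂ)
    (R1 : Matrix (Fin m) (Fin m) ℂ) (R2 R3 : Matrix (Fin p) (Fin p) ℂ) :
    GG A0 A B C Kp Kd Ui Vi (c * σ) (c * s) (c * h) e R1 R2 R3
      = c • GG A0 A B C Kp Kd Ui Vi σ s h e R1 R2 R3 := by
  unfold GG
  rw [Matrix.fromBlocks_smul]
  congr 1
  · have h1 : (c * s) • Kp + (c * h) • (Kd * R2) = c • (s • Kp + h • (Kd * R2)) := by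
      rw [smul_add, smul_smul, smul_smul]
    rw [h1, Matrix.mul_smul, Matrix.smul_mul]
    simp only [smul_sub, Finset.smul_sum, smul_smul, mul_assoc]
  · simp [smul_smul]
  · simp [smul_smul]
  · simp [smul_smul]

lemma GG_tendsto {ι : Type*} {l : Filter ι} {σ s h : ι → ℂ} {e : ι → Fin K → ℂ}
    {R1 : ι → Matrix (Fin m) (Fin m) ℂ} {R2 R3 : ι → Matrix (Fin p) (Fin p) ℂ}
    {σ' s' h' : ℂ} {e' : Fin K → ℂ}
    {R1' : Matrix (Fin m) (Fin m) ℂ} {R2' R3' : Matrix (Fin p) (Fin p) ℂ} [l.NeBot]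
    (hσ : Filter.Tendsto σ l (nhds σ')) (hs : Filter.Tendsto s l (nhds s'))
    (hh : Filter.Tendsto h l (nhds h')) (he : Filter.Tendsto e l (nhds e'))
    (h1 : Filter.Tendsto R1 l (nhds R1')) (h2 : Filter.Tendsto R2 l (nhds R2'))
    (h3 : Filter.Tendsto R3 l (nhds R3'))
    (h0 : ∀ᶠ i in l,
      (GG A0 A B C Kp Kd Ui Vi (σ i) (s i) (h i) (e i) (R1 i) (R2 i) (R3 i)).det = 0) :
    (GG A0 A B C Kp Kd Ui Vi σ' s' h' e' R1' R2' R3').det = 0 := by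
  have hc : Continuous (fun x : ℂ × ℂ × ℂ × (Fin K → ℂ) × Matrix (Fin m) (Fin m) ℂ ×
      Matrix (Fin p) (Fin p) ℂ × Matrix (Fin p) (Fin p) ℂ =>
      (GG A0 A B C Kp Kd Ui Vi x.1 x.2.1 x.2.2.1 x.2.2.2.1 x.2.2.2.2.1 x.2.2.2.2.2.1
        x.2.2.2.2.2.2).det) := by
    unfold GG
    refine Continuous.matrix_det (Continuous.matrix_fromBlocks ?_ ?_ ?_ ?_) <;> fun_prop
  have ht := (hc.tendsto (σ', s', h', e', R1', R2', R3')).comp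
    (hσ.prodMk_nhds (hs.prodMk_nhds (hh.prodMk_nhds (he.prodMk_nhds (h1.prodMk_nhds
      (h2.prodMk_nhds h3))))))
  refine tendsto_nhds_unique ht ((tendsto_const_nhds (x := (0 : ℂ))).congr' ?_)
  filter_upwards [h0] with i hi
  exact hi.symm

lemma GG_inf (h : ℂ) (e : Fin K → ℂ)
    (R1 : Matrix (Fin m) (Fin m) ℂ) (R2 R3 : Matrix (Fin p) (Fin p) ℂ) :
    (GG A0 A B C Kp Kd Ui Vi 1 0 h e R1 R2 R3).det
      = (1 - h • (B * R1 * (Kd * R2) * (R3 * C))).det := by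
  unfold GG
  simp

end

lemma ultra_C {ι : Type*} (l : Ultrafilter ι) (f : ι → ℂ) (M : ℝ)
    (h : ∀ᶠ i in (l : Filter ι), ‖f i‖ ≤ M) : ∃ z, Filter.Tendsto f l (nhds z) := by
  have hc := isCompact_closedBall (0 : ℂ) M
  have := hc.ultrafilter_le_nhds (l.map f) (by
    rw [Filter.le_principal_iff]
    show ∀ᶠ i in (l : Filter ι), f i ∈ Metric.closedBall 0 M
    filter_upwards [h] with i hi
    simpa using hi)
  obtain ⟨z, -, hz⟩ := this
  exact ⟨z, hz⟩

lemma ultra_M {ι : Type*} {s : ℕ} (l : Ultrafilter ι) (f : ι → Matrix (Fin s) (Fin s) ℂ) (M : ℝ)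
    (h : ∀ᶠ i in (l : Filter ι), ‖f i‖ ≤ M) : ∃ z, Filter.Tendsto f l (nhds z) := by
  have h1 : ∀ a b, ∃ z, Filter.Tendsto (fun i => f i a b) l (nhds z) := by
    intro a b
    apply ultra_C l _ M
    filter_upwards [h] with i hi
    exact (Matrix.norm_entry_le_entrywise_sup_norm (f i)).trans hi
  choose z hz using h1
  refine ⟨Matrix.of z, ?_⟩
  exact tendsto_pi_nhds.2 fun a => tendsto_pi_nhds.2 fun b => hz a b

lemma ultra_dich {ι : Type*} (l : Ultrafilter ι) (f : ι → ℂ) :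
    (∃ z, Filter.Tendsto f l (nhds z)) ∨
    (Filter.Tendsto (fun i => (f i)⁻¹) l (nhds 0) ∧ ∀ᶠ i in (l : Filter ι), f i ≠ 0) := by
  by_cases h : ∃ M : ℝ, ∀ᶠ i in (l : Filter ι), ‖f i‖ ≤ M
  · obtain ⟨M, hM⟩ := h
    exact Or.inl (ultra_C l f M hM)
  · push Not at h
    have h' : ∀ M : ℝ, ∀ᶠ i in (l : Filter ι), M < ‖f i‖ := by
      intro M
      exact h M
    right
    constructor
    · have : Filter.Tendsto (fun i => ‖f i‖) l Filter.atTop := by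
        rw [Filter.tendsto_atTop]
        intro b
        filter_upwards [h' b] with i hi using hi.le
      exact Filter.tendsto_inv₀_cobounded.comp (tendsto_norm_atTop_iff_cobounded.1 this)
    · filter_upwards [h' 0] with i hi
      exact norm_pos_iff.1 hi

lemma ultra_exp {ι : Type*} {K : ℕ} (l : Ultrafilter ι) (f : ι → ℂ) (τ : Fin K → ℝ)
    (hτ : ∀ k, 0 < τ k) (h : ∀ᶠ i in (l : Filter ι), -1 ≤ (f i).re) :
    ∃ e, Filter.Tendsto (fun i (k : Fin K) => Complex.exp (-f i * (τ k : ℂ))) l (nhds e) := by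
  have h1 : ∀ k, ∃ z, Filter.Tendsto (fun i => Complex.exp (-f i * (τ k : ℂ))) l (nhds z) := by
    intro k
    apply ultra_C l _ (Real.exp (τ k))
    filter_upwards [h] with i hi
    rw [Complex.norm_exp]
    apply Real.exp_le_exp.2
    simp
    nlinarith [hτ k]
  choose z hz using h1
  exact ⟨z, tendsto_pi_nhds.2 hz⟩

lemma exp_tendsto {ι : Type*} {K : ℕ} {l : Filter ι} {f : ι → ℂ} {z : ℂ} (τ : Fin K → ℝ)
    (h : Filter.Tendsto f l (nhds z)) :
    Filter.Tendsto (fun i (k : Fin K) => Complex.exp (-f i * (τ k : ℂ))) l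
      (nhds fun k => Complex.exp (-z * (τ k : ℂ))) := by
  have hc : Continuous (fun (z : ℂ) (k : Fin K) => Complex.exp (-z * (τ k : ℂ))) := by fun_prop
  exact (hc.tendsto z).comp h

lemma inv_T_tendsto : Filter.Tendsto (fun k : ℕ => 1 / ((k : ℝ) + 1))
    (Filter.hyperfilter ℕ : Filter ℕ) (nhds 0) :=
  (tendsto_one_div_add_atTop_nhds_zero_nat (𝕜 := ℝ)).mono_left Nat.hyperfilter_le_atTop

lemma adm_conv {s : ℕ} {R : ℂ → ℝ → Matrix (Fin s) (Fin s) ℂ} (hR : Admissible s R)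
    {l : Filter ℕ} {f : ℕ → ℂ} {r : ℕ → ℝ} {z : ℂ} (hf : Filter.Tendsto f l (nhds z))
    (hr0 : ∀ k, 0 < r k) (hr : Filter.Tendsto r l (nhds 0)) :
    Filter.Tendsto (fun k => R (f k) (r k)) l (nhds 1) := by
  have key : ∀ ε : ℝ, 0 < ε → ∀ᶠ k in l, ‖R (f k) (r k) - 1‖ ≤ ε := by
    intro ε hε
    obtain ⟨δ, hδ, H⟩ := hR.unif_conv _ (isCompact_closedBall z 1) ε hε
    filter_upwards [hr.eventually (gt_mem_nhds hδ),
      hf.eventually (Metric.closedBall_mem_nhds z one_pos)] with k h1 h2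
    exact H _ (hr0 k) h1 _ h2
  refine tendsto_pi_nhds.2 fun a => tendsto_pi_nhds.2 fun b => ?_
  rw [Metric.tendsto_nhds]
  intro ε hε
  filter_upwards [key (ε / 2) (by positivity)] with k hk
  have := (Matrix.norm_entry_le_entrywise_sup_norm (R (f k) (r k) - 1) (i := a) (j := b)).trans hk
  rw [dist_eq_norm]
  simp only [Matrix.sub_apply] at this
  linarith

lemma adm_lim {s : ℕ} {R : ℂ → ℝ → Matrix (Fin s) (Fin s) ℂ} (hR : Admissible s R)
    {l : Ultrafilter ℕ} {f : ℕ → ℂ} {r : ℕ → ℝ} {c : ℕ → ℝ}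
    (hf : ∀ k, - c k < (f k).re) (hc : Filter.Tendsto c l (nhds 0))
    (hr0 : ∀ k, 0 < r k) (hr : Filter.Tendsto r l (nhds 0)) :
    ∃ z, Filter.Tendsto (fun k => R (f k) (r k)) l (nhds z) := by
  obtain ⟨M, N, rb, hM, hN, hrb, H⟩ := hR.bounded
  apply ultra_M l _ M
  filter_upwards [hr.eventually (gt_mem_nhds hrb), hc.eventually (gt_mem_nhds hN)] with k h1 h2
  exact H _ (by linarith [hf k]) _ (hr0 k) h1

/-- Proposition 4.2: if the nominal closed loop is exponentially stable and
`B·K_d·C − Iₙ` is Hurwitz, then the closed loop with low-pass filter is strongly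
stable for all sufficiently small time constants `T`. -/
theorem stmt8 {n m p q K : ℕ}
    (hn : 0 < n) (hm : 0 < m) (hp : 0 < p) (hK : 0 < K)
    (A0 : Matrix (Fin n) (Fin n) ℝ) (A : Fin K → Matrix (Fin n) (Fin n) ℝ)
    (τ : Fin K → ℝ) (hτpos : ∀ k, 0 < τ k) (hτmono : StrictMono τ)
    (B : Matrix (Fin n) (Fin m) ℝ) (hB : B.rank = m)
    (C : Matrix (Fin p) (Fin n) ℝ) (hC : C.rank = p)
    (Kp Kd Ki : Matrix (Fin m) (Fin p) ℝ)
    (Ui : Matrix (Fin m) (Fin q) ℝ) (Vi : Matrix (Fin q) (Fin p) ℝ)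
    (hfact : Ki = Ui * Vi) (hUi : Ui.rank = q) (hVi : Vi.rank = q) (hKi : Ki.rank = q)
    (hstab : ∃ δ : ℝ, 0 < δ ∧ ∀ lam : ℂ,
      H0 A0 A τ B C Kp Kd Ui Vi lam = 0 → lam.re ≤ -δ)
    (hHurwitz : ∀ μ : ℂ,
      (μ • (1 : Matrix (Fin n) (Fin n) ℂ) - cM B * cM Kd * cM C).det = 0 → μ.re < 1) :
    ∃ That : ℝ, 0 < That ∧ ∀ T : ℝ, 0 < T → T < That →
      ∀ (R1 : ℂ → ℝ → Matrix (Fin m) (Fin m) ℂ)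
        (R2 R3 : ℂ → ℝ → Matrix (Fin p) (Fin p) ℂ),
        Admissible m R1 → Admissible p R2 → Admissible p R3 →
        (∀ (lam : ℂ) (r : ℝ), 0 ≤ r → IsUnit (R1 lam r)) →
        (∀ (lam : ℂ) (r : ℝ), 0 ≤ r → IsUnit (R3 lam r)) →
        ∃ rhat c : ℝ, 0 < rhat ∧ 0 < c ∧
          ∀ r1 r2 r3 : ℝ, 0 < r1 → r1 < rhat → 0 < r2 → r2 < rhat → 0 < r3 → r3 < rhat →
            ∀ lam : ℂ, -c < lam.re →
              H4 A0 A τ B C Kp Kd Ui Vi R1 R2 R3 lam T r1 r2 r3 ≠ 0 := by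
  obtain ⟨δ, hδ, hst⟩ := hstab
  -- Step 2: unperturbed filtered system
  have step2 : ∃ That : ℝ, 0 < That ∧ ∀ T : ℝ, 0 < T → T < That → ∀ lam : ℂ, 0 ≤ lam.re →
      (GG (cM A0) (fun k => cM (A k)) (cM B) (cM C) (cM Kp) (cM Kd) (cM Ui) (cM Vi)
      lam 1 (lam / (lam * (T : ℂ) + 1)) (fun k => Complex.exp (-lam * (τ k : ℂ)))
      1 1 1).det ≠ 0 := by
    by_contra hcon
    push Not at hcon
    have hcon' := fun k : ℕ => hcon (1 / ((k : ℝ) + 1)) (by positivity)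
    choose T hT0 hT1 lam hre hdet using hcon'
    set l : Ultrafilter ℕ := Filter.hyperfilter ℕ with hl
    have hTt : Filter.Tendsto T l (nhds 0) :=
      squeeze_zero (fun k => (hT0 k).le) (fun k => (hT1 k).le) inv_T_tendsto
    have hTc : Filter.Tendsto (fun k => (T k : ℂ)) l (nhds 0) := by
      have := (Complex.continuous_ofReal.tendsto 0).comp hTt
      rw [Complex.ofReal_zero] at this
      exact this
    have hwre : ∀ k, 1 ≤ (lam k * (T k : ℂ) + 1).re := by
      intro k
      simp
      exact mul_nonneg (hre k) (hT0 k).le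
    have hne : ∀ k, lam k * (T k : ℂ) + 1 ≠ 0 := by
      intro k h
      have := hwre k
      rw [h] at this
      norm_num at this
    rcases ultra_dich l lam with ⟨z, hz⟩ | ⟨hinv, hnz⟩
    · have hg : Filter.Tendsto (fun k => lam k / (lam k * (T k : ℂ) + 1)) l (nhds z) := by
        have := hz.div ((hz.mul hTc).add_const 1) (by simp)
        rw [mul_zero, zero_add, div_one] at this
        exact this
      have h0 := GG_tendsto _ _ _ _ _ _ _ _ hz (tendsto_const_nhds (x := (1 : ℂ))) hg
        (exp_tendsto τ hz) tendsto_const_nhds tendsto_const_nhds tendsto_const_nhds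
        (Filter.Eventually.of_forall hdet)
      rw [← H0_eq] at h0
      have h1 := hst z h0
      have h2 : 0 ≤ z.re := ge_of_tendsto ((Complex.continuous_re.tendsto z).comp hz)
        (Filter.Eventually.of_forall hre)
      linarith
    · obtain ⟨e, he⟩ := ultra_exp l lam τ hτpos
        (Filter.Eventually.of_forall fun k => by linarith [hre k])
      obtain ⟨w, hw⟩ := ultra_C l (fun k => (lam k * (T k : ℂ) + 1)⁻¹) 1
        (Filter.Eventually.of_forall fun k => by
          rw [norm_inv]
          exact inv_le_one_of_one_le₀ ((hwre k).trans (Complex.re_le_norm _)))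
      have h0 := GG_tendsto (cM A0) (fun k => cM (A k)) (cM B) (cM C) (cM Kp) (cM Kd) (cM Ui)
        (cM Vi) (tendsto_const_nhds (x := (1 : ℂ))) hinv hw he
        (tendsto_const_nhds (x := 1)) (tendsto_const_nhds (x := 1)) (tendsto_const_nhds (x := 1))
        (by
          filter_upwards [hnz] with k hk
          have := GG_smul (cM A0) (fun k => cM (A k)) (cM B) (cM C) (cM Kp) (cM Kd) (cM Ui)
            (cM Vi) (lam k)⁻¹ (lam k) 1 (lam k / (lam k * (T k : ℂ) + 1))
            (fun j => Complex.exp (-lam k * (τ j : ℂ))) 1 1 1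
          rw [inv_mul_cancel₀ hk, mul_one, ← mul_div_assoc, inv_mul_cancel₀ hk, one_div] at this
          rw [this, Matrix.det_smul, hdet k, mul_zero])
      rw [GG_inf] at h0
      simp only [Matrix.mul_one, Matrix.one_mul] at h0
      by_cases hw0 : w = 0
      · rw [hw0] at h0
        simp at h0
      · have h1 := hHurwitz w⁻¹ (by
          have : w⁻¹ • (1 : Matrix (Fin n) (Fin n) ℂ) - cM B * cM Kd * cM C
              = w⁻¹ • (1 - w • (cM B * cM Kd * cM C)) := by
            rw [smul_sub, smul_smul, inv_mul_cancel₀ hw0, one_smul]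
          rw [this, Matrix.det_smul, h0, mul_zero])
        have h2 : 1 ≤ (w⁻¹).re := ge_of_tendsto
          ((Complex.continuous_re.tendsto _).comp (hw.inv₀ hw0))
          (Filter.Eventually.of_forall fun k => by simpa using hwre k)
        linarith
  obtain ⟨That, hThat, H⟩ := step2
  refine ⟨That, hThat, fun T hT hTT R1 R2 R3 hR1 hR2 hR3 _ _ => ?_⟩
  have HT := H T hT hTT
  by_contra hcon
  push Not at hcon
  have hcon' := fun k : ℕ => hcon (1 / ((k : ℝ) + 1)) (1 / ((k : ℝ) + 1)) (by positivity)
    (by positivity)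
  choose r1 r2 r3 h1p h1l h2p h2l h3p h3l lam hre hdet using hcon'
  set l : Ultrafilter ℕ := Filter.hyperfilter ℕ with hl
  have hr1 : Filter.Tendsto r1 l (nhds 0) :=
    squeeze_zero (fun k => (h1p k).le) (fun k => (h1l k).le) inv_T_tendsto
  have hr2 : Filter.Tendsto r2 l (nhds 0) :=
    squeeze_zero (fun k => (h2p k).le) (fun k => (h2l k).le) inv_T_tendsto
  have hr3 : Filter.Tendsto r3 l (nhds 0) :=
    squeeze_zero (fun k => (h3p k).le) (fun k => (h3l k).le) inv_T_tendsto
  simp only [H4_eq] at hdet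
  have hTne : (T : ℂ) ≠ 0 := by exact_mod_cast hT.ne'
  rcases ultra_dich l lam with ⟨z, hz⟩ | ⟨hinv, hnz⟩
  · have hz0 : 0 ≤ z.re := by
      have := inv_T_tendsto.neg
      rw [neg_zero] at this
      exact le_of_tendsto_of_tendsto this ((Complex.continuous_re.tendsto z).comp hz)
        (Filter.Eventually.of_forall fun k => (hre k).le)
    have hne : z * (T : ℂ) + 1 ≠ 0 := by
      intro h
      have := congrArg Complex.re h
      simp at this
      nlinarith [mul_nonneg hz0 hT.le]
    have hg : Filter.Tendsto (fun k => lam k / (lam k * (T : ℂ) + 1)) l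
        (nhds (z / (z * (T : ℂ) + 1))) := hz.div ((hz.mul_const _).add_const 1) hne
    exact HT z hz0 (GG_tendsto _ _ _ _ _ _ _ _ hz (tendsto_const_nhds (x := (1 : ℂ))) hg
      (exp_tendsto τ hz) (adm_conv hR1 hz h1p hr1) (adm_conv hR2 hz h2p hr2)
      (adm_conv hR3 hz h3p hr3) (Filter.Eventually.of_forall hdet))
  · obtain ⟨e, he⟩ := ultra_exp l lam τ hτpos
      (Filter.Eventually.of_forall fun k => by
        have h1 : 1 / ((k : ℝ) + 1) ≤ 1 := by
          rw [div_le_one (by positivity)]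
          linarith [Nat.cast_nonneg (α := ℝ) k]
        linarith [hre k])
    obtain ⟨S1, hS1⟩ := adm_lim hR1 hre inv_T_tendsto h1p hr1
    obtain ⟨S2, hS2⟩ := adm_lim hR2 hre inv_T_tendsto h2p hr2
    obtain ⟨S3, hS3⟩ := adm_lim hR3 hre inv_T_tendsto h3p hr3
    have hw : Filter.Tendsto (fun k => (lam k)⁻¹ * (lam k / (lam k * (T : ℂ) + 1))) l
        (nhds 0) := by
      have h1 : Filter.Tendsto (fun k => (lam k)⁻¹ * ((T : ℂ) + (lam k)⁻¹)⁻¹) l (nhds 0) := by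
        have := hinv.mul ((hinv.const_add (T : ℂ)).inv₀ (by simpa using hTne))
        simpa using this
      refine h1.congr' ?_
      filter_upwards [hnz] with k hk
      rw [← mul_div_assoc, inv_mul_cancel₀ hk, ← mul_inv, mul_add, mul_inv_cancel₀ hk, one_div]
    have h0 := GG_tendsto (cM A0) (fun k => cM (A k)) (cM B) (cM C) (cM Kp) (cM Kd) (cM Ui)
      (cM Vi) (tendsto_const_nhds (x := (1 : ℂ))) hinv hw he hS1 hS2 hS3
      (by
        filter_upwards [hnz] with k hk
        have := GG_smul (cM A0) (fun k => cM (A k)) (cM B) (cM C) (cM Kp) (cM Kd) (cM Ui)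
          (cM Vi) (lam k)⁻¹ (lam k) 1 (lam k / (lam k * (T : ℂ) + 1))
          (fun j => Complex.exp (-lam k * (τ j : ℂ))) (R1 (lam k) (r1 k)) (R2 (lam k) (r2 k))
          (R3 (lam k) (r3 k))
        rw [inv_mul_cancel₀ hk, mul_one] at this
        rw [this, Matrix.det_smul, hdet k, mul_zero])
    rw [GG_inf] at h0
    simp at h0
end

section
/- (Proposition 6.1.) Let τ_u > 0 and assume the input-delayed nominal closed loop is exponentially stable, i.e. there exists δ > 0 such that every λ ∈ ℂ with H^{τ_u}(λ) = 0 satisfies Re λ ≤ −δ. Then the closed loop with low-pass filter is strongly stable for sufficiently small T: there exists T̂ > 0 such that for every T ∈ (0, T̂) and every perturbation triple (R₁, R₂, R₃) there exist r̂ > 0 and c > 0 such that for all r₁, r₂, r₃ ∈ (0, r̂), every λ ∈ ℂ with Re λ > −c satisfies H₆(λ; T, r₁, r₂, r₃) ≠ 0. -/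
open Matrix

attribute [local instance] Matrix.normedAddCommGroup

/-- The nominal characteristic function `H^{τᵤ}` of the closed loop with input
delay `τᵤ`. -/
noncomputable def Htau {n m p q K : ℕ}
    (A0 : Matrix (Fin n) (Fin n) ℝ) (A : Fin K → Matrix (Fin n) (Fin n) ℝ)
    (τ : Fin K → ℝ) (τu : ℝ)
    (B : Matrix (Fin n) (Fin m) ℝ) (C : Matrix (Fin p) (Fin n) ℝ)
    (Kp Kd : Matrix (Fin m) (Fin p) ℝ)
    (Ui : Matrix (Fin m) (Fin q) ℝ) (Vi : Matrix (Fin q) (Fin p) ℝ)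
    (lam : ℂ) : ℂ :=
  (lam • ((1 : Matrix (Fin n ⊕ Fin q) (Fin n ⊕ Fin q) ℂ)
      - Complex.exp (-lam * (τu : ℂ)) •
          Matrix.fromBlocks (cM B * cM Kd * cM C) 0 0 (0 : Matrix (Fin q) (Fin q) ℂ))
    - Matrix.fromBlocks (cM A0) 0 (cM Vi * cM C) (0 : Matrix (Fin q) (Fin q) ℂ)
    - Complex.exp (-lam * (τu : ℂ)) •
        Matrix.fromBlocks (cM B * cM Kp * cM C) (cM B * cM Ui) 0 (0 : Matrix (Fin q) (Fin q) ℂ)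
    - ∑ k : Fin K, Complex.exp (-lam * (τ k : ℂ)) •
        Matrix.fromBlocks (cM (A k)) 0 0 (0 : Matrix (Fin q) (Fin q) ℂ)).det

/-- The perturbed low-pass-filtered characteristic function
`H₆(λ; T, r₁, r₂, r₃)` for the system with input delay `τᵤ`. -/
noncomputable def H6 {n m p q K : ℕ}
    (A0 : Matrix (Fin n) (Fin n) ℝ) (A : Fin K → Matrix (Fin n) (Fin n) ℝ)
    (τ : Fin K → ℝ) (τu : ℝ)
    (B : Matrix (Fin n) (Fin m) ℝ) (C : Matrix (Fin p) (Fin n) ℝ)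
    (Kp Kd : Matrix (Fin m) (Fin p) ℝ)
    (Ui : Matrix (Fin m) (Fin q) ℝ) (Vi : Matrix (Fin q) (Fin p) ℝ)
    (R1 : ℂ → ℝ → Matrix (Fin m) (Fin m) ℂ)
    (R2 R3 : ℂ → ℝ → Matrix (Fin p) (Fin p) ℂ)
    (lam : ℂ) (T r1 r2 r3 : ℝ) : ℂ :=
  (lam • (1 : Matrix (Fin n ⊕ Fin q) (Fin n ⊕ Fin q) ℂ)
    - Matrix.fromBlocks (cM A0) 0 0 (0 : Matrix (Fin q) (Fin q) ℂ)
    - ∑ k : Fin K, Complex.exp (-lam * (τ k : ℂ)) •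
        Matrix.fromBlocks (cM (A k)) 0 0 (0 : Matrix (Fin q) (Fin q) ℂ)
    - Matrix.fromBlocks (Complex.exp (-lam * (τu : ℂ)) • (cM B * R1 lam r1)) 0 0
        (1 : Matrix (Fin q) (Fin q) ℂ)
      * Matrix.fromBlocks
          (cM Kp + (lam / (lam * (T : ℂ) + 1)) • (cM Kd * R2 lam r2))
          (cM Ui) (cM Vi) (0 : Matrix (Fin q) (Fin q) ℂ)
      * Matrix.fromBlocks (R3 lam r3 * cM C) 0 0 (1 : Matrix (Fin q) (Fin q) ℂ)).det

attribute [local instance] Matrix.normedSpace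

open Filter Topology in
lemma tube_aux {X Y : Type*} [TopologicalSpace X] [PseudoMetricSpace Y] {S : Set X}
    (hS : IsCompact S) (f : X × Y → ℝ) (y0 : Y)
    (hf : ∀ x ∈ S, ContinuousAt f (x, y0)) (hpos : ∀ x ∈ S, 0 < f (x, y0)) :
    ∃ ε : ℝ, 0 < ε ∧ ∀ x ∈ S, ∀ y, dist y y0 < ε → 0 < f (x, y) := by
  have h := hS.eventually_forall_of_forall_eventually (x₀ := y0)
    (P := fun y x => 0 < f (x, y)) (by
      intro x hx
      have h1 : ∀ᶠ z in 𝓝 (x, y0), 0 < f z := (hf x hx).eventually (lt_mem_nhds (hpos x hx))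
      have h2 : Tendsto Prod.swap (𝓝 (y0, x)) (𝓝 (x, y0)) := continuous_swap.tendsto (y0, x)
      exact h2.eventually h1)
  obtain ⟨ε, hε, h'⟩ := Metric.eventually_nhds_iff.1 h
  exact ⟨ε, hε, fun x hx y hy => h' hy x hx⟩

lemma det_diff_aux {N : Type*} [Fintype N] [DecidableEq N] (F : ℂ → Matrix N N ℂ) (w : ℂ)
    (hF : ∀ i j, DifferentiableAt ℂ (fun w => F w i j) w) :
    DifferentiableAt ℂ (fun w => (F w).det) w := by
  simp_rw [Matrix.det_apply']
  refine DifferentiableAt.fun_sum fun σ _ => ?_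
  refine DifferentiableAt.const_mul ?_ _
  exact DifferentiableAt.fun_finsetProd fun i _ => hF _ _

lemma det_scale_aux {N : Type*} [Fintype N] [DecidableEq N] (w : ℂ) (hw : w ≠ 0)
    (X : Matrix N N ℂ) (Q : Matrix N N ℂ) (h : (w • X - Q).det ≠ 0) :
    (X - w⁻¹ • Q).det ≠ 0 := by
  intro h0
  apply h
  have : w • X - Q = w • (X - w⁻¹ • Q) := by
    rw [smul_sub, smul_smul, mul_inv_cancel₀ hw, one_smul]
  rw [this, Matrix.det_smul, h0, mul_zero]

lemma det_scale_aux' {N : Type*} [Fintype N] [DecidableEq N] (w : ℂ) (hw : w ≠ 0)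
    (X : Matrix N N ℂ) (Q : Matrix N N ℂ) (h : (X - w⁻¹ • Q).det ≠ 0) :
    (w • X - Q).det ≠ 0 := by
  have : w • X - Q = w • (X - w⁻¹ • Q) := by
    rw [smul_sub, smul_smul, mul_inv_cancel₀ hw, one_smul]
  rw [this, Matrix.det_smul]
  exact mul_ne_zero (pow_ne_zero _ hw) h

open Filter Topology in
lemma chain_aux {N : Type*} [Fintype N] [DecidableEq N] (D : Matrix N N ℂ)
    (Q : ℂ → Matrix N N ℂ) (hQd : ∀ i j, Differentiable ℂ (fun w => Q w i j)) (Cb : ℝ)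
    (hQb : ∀ w : ℂ, -1 ≤ w.re → ‖Q w‖ ≤ Cb) (t : ℝ) (ht : 0 < t) (δ : ℝ) (hδ : 0 < δ)
    (hst : ∀ w : ℂ, -δ < w.re →
      (w • ((1 : Matrix N N ℂ) - Complex.exp (-w * (t : ℂ)) • D) - Q w).det ≠ 0)
    (z : ℂ) (hz : ‖z‖ ≤ 1) : ((1 : Matrix N N ℂ) - z • D).det ≠ 0 := by
  intro h0
  have htC : (t : ℂ) ≠ 0 := by exact_mod_cast ht.ne'
  have hz0 : z ≠ 0 := by
    rintro rfl
    simp at h0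
  have hexp : ∀ u : ℂ, u ≠ 0 → Complex.exp (-(-Complex.log u / t) * (t : ℂ)) = u := by
    intro u hu
    have : -(-Complex.log u / t) * (t : ℂ) = Complex.log u := by field_simp
    rw [this, Complex.exp_log hu]
  set w0 : ℂ := -Complex.log z / t with hw0
  have hw0re : 0 ≤ w0.re := by
    have : w0 = ((1 / t : ℝ) : ℂ) * (-Complex.log z) := by
      rw [hw0]; push_cast; field_simp
    rw [this, Complex.re_ofReal_mul, Complex.neg_re, Complex.log_re]
    have := Real.log_nonpos (norm_nonneg z) hz
    have : 0 ≤ 1 / t := by positivity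
    apply mul_nonneg this; linarith
  set g : ℂ → ℂ := fun w => ((1 : Matrix N N ℂ) - Complex.exp (-w * (t : ℂ)) • D).det with hg
  have hgd : Differentiable ℂ g := by
    intro w
    refine det_diff_aux _ w fun i j => ?_
    simp only [Matrix.sub_apply, Matrix.smul_apply, smul_eq_mul]
    fun_prop
  have hg0 : g w0 = 0 := by
    simp only [hg]; rw [hexp z hz0]; exact h0
  -- g is not identically zero
  have hgne : ∃ w, g w ≠ 0 := by
    have hc : Continuous fun u : ℂ => ((1 : Matrix N N ℂ) - u • D).det :=
      Continuous.matrix_det (by fun_prop)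
    have h1 : ∀ᶠ u in 𝓝 (0 : ℂ), ((1 : Matrix N N ℂ) - u • D).det ≠ 0 := by
      apply hc.continuousAt.eventually_ne
      simp
    have h2 : ∀ᶠ u in 𝓝[≠] (0 : ℂ), ((1 : Matrix N N ℂ) - u • D).det ≠ 0 :=
      h1.filter_mono nhdsWithin_le_nhds
    obtain ⟨u, hu, hu0⟩ := (h2.and self_mem_nhdsWithin).exists
    refine ⟨-Complex.log u / t, ?_⟩
    simp only [hg]; rw [hexp u hu0]; exact hu
  have hiso : ∀ᶠ w in 𝓝[≠] w0, g w ≠ 0 := by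
    by_contra hcon
    have hfr : ∃ᶠ w in 𝓝[≠] w0, g w = 0 := by
      intro h; exact hcon h
    have han : AnalyticOnNhd ℂ g Set.univ := fun w _ => hgd.analyticAt w
    have := han.eqOn_zero_of_preconnected_of_frequently_eq_zero isPreconnected_univ
      (Set.mem_univ w0) hfr
    obtain ⟨w, hw⟩ := hgne
    exact hw (this (Set.mem_univ w))
  rw [eventually_nhdsWithin_iff, Metric.eventually_nhds_iff] at hiso
  obtain ⟨ρ, hρ, hiso⟩ := hiso
  obtain ⟨r, hr, hrρ, hr1, hrδ⟩ : ∃ r : ℝ, 0 < r ∧ r < ρ ∧ r ≤ 1 ∧ r < δ := by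
    refine ⟨min (ρ/2) (min 1 (δ/2)), by positivity, ?_, ?_, ?_⟩
    · exact (min_le_left _ _).trans_lt (by linarith)
    · exact (min_le_right _ _).trans (min_le_left _ _)
    · exact ((min_le_right _ _).trans (min_le_right _ _)).trans_lt (by linarith)
  have hsph : ∀ w ∈ Metric.sphere w0 r, g w ≠ 0 := by
    intro w hw
    rw [Metric.mem_sphere] at hw
    apply hiso (by rw [hw]; exact hrρ)
    intro h
    rw [Set.mem_singleton_iff] at h
    rw [h, dist_self] at hw; linarith
  obtain ⟨m, hm, hmb⟩ : ∃ m : ℝ, 0 < m ∧ ∀ w ∈ Metric.sphere w0 r, m < ‖g w‖ := by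
    obtain ⟨w1, hw1, hmin⟩ := (isCompact_sphere w0 r).exists_isMinOn
      (NormedSpace.sphere_nonempty.2 hr.le) (f := fun w => ‖g w‖) hgd.continuous.norm.continuousOn
    have h1 : 0 < ‖g w1‖ := norm_pos_iff.2 (hsph w1 hw1)
    refine ⟨‖g w1‖ / 2, by positivity, fun w hw => ?_⟩
    have : ‖g w1‖ ≤ ‖g w‖ := hmin hw
    linarith
  set F : ℂ × Matrix N N ℂ → ℂ :=
    fun x => ((1 : Matrix N N ℂ) - Complex.exp (-x.1 * (t : ℂ)) • D - x.2).det with hF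
  have hFc : Continuous F := Continuous.matrix_det (by fun_prop)
  obtain ⟨ε1, hε1, hb1⟩ := tube_aux (isCompact_sphere w0 r) (fun x => ‖F x‖ - m)
    (0 : Matrix N N ℂ) (fun x _ => by fun_prop) (fun x hx => by
      have := hmb x hx
      simp only [hF, sub_zero]
      exact sub_pos.2 this)
  obtain ⟨ε2, hε2, hb2⟩ := tube_aux (isCompact_singleton (x := w0)) (fun x => m - ‖F x‖)
    (0 : Matrix N N ℂ) (fun x _ => by fun_prop) (fun x hx => by
      rw [Set.mem_singleton_iff] at hx
      subst hx
      have : F (w0, 0) = 0 := by simp only [hF, sub_zero]; exact hg0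
      rw [this]; simpa using hm)
  have hb2 := hb2 w0 rfl
  set ε := min ε1 ε2 with hε
  have hεp : 0 < ε := lt_min hε1 hε2
  -- choose shift
  obtain ⟨k, hk⟩ := exists_nat_gt ((|Cb| / ε + 1 + ‖w0‖ + 1) * t / (2 * Real.pi))
  set s : ℂ := (k : ℂ) * (2 * Real.pi * Complex.I) / t with hs
  have hsn : |Cb| / ε + 1 + ‖w0‖ + 1 < ‖s‖ := by
    have : ‖s‖ = k * (2 * Real.pi) / t := by
      rw [hs]; simp [abs_of_pos Real.pi_pos, abs_of_pos ht]
    rw [this, lt_div_iff₀ ht]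
    rwa [div_lt_iff₀ (by positivity)] at hk
  have hsre : s.re = 0 := by
    rw [hs, Complex.div_ofReal_re]
    simp
  have hexps : ∀ w : ℂ, Complex.exp (-(w + s) * (t : ℂ)) = Complex.exp (-w * (t : ℂ)) := by
    intro w
    have : -(w + s) * (t : ℂ) = -w * t + ((-k : ℤ) : ℂ) * (2 * Real.pi * Complex.I) := by
      rw [hs]; push_cast; field_simp; ring
    rw [this, Complex.exp_add, Complex.exp_int_mul_two_pi_mul_I, mul_one]
  set E : ℂ → Matrix N N ℂ := fun w => (w + s)⁻¹ • Q (w + s) with hE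
  have hball : ∀ w ∈ Metric.closedBall w0 r,
      -1 ≤ w.re ∧ -δ < w.re ∧ |Cb| / ε + 1 < ‖w + s‖ := by
    intro w hw
    rw [Metric.mem_closedBall, dist_eq_norm] at hw
    have h1 := (abs_le.1 (Complex.abs_re_le_norm (w - w0))).1
    rw [Complex.sub_re] at h1
    refine ⟨by linarith, by linarith, ?_⟩
    have h2 : ‖s‖ ≤ ‖w + s‖ + ‖w - w0‖ + ‖w0‖ := by
      have : s = (w + s) - (w - w0) - w0 := by ring
      calc ‖s‖ = ‖(w + s) - (w - w0) - w0‖ := by rw [← this]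
        _ ≤ ‖(w + s) - (w - w0)‖ + ‖w0‖ := norm_sub_le _ _
        _ ≤ _ := by gcongr; exact norm_sub_le _ _
    linarith
  have hEn : ∀ w ∈ Metric.closedBall w0 r, ‖E w‖ < ε := by
    intro w hw
    obtain ⟨h1, h2, h3⟩ := hball w hw
    have h4 : ‖Q (w + s)‖ ≤ |Cb| := (hQb _ (by simpa [hsre] using h1)).trans (le_abs_self _)
    have h5 : 0 < ‖w + s‖ := lt_of_le_of_lt (by positivity) h3
    simp only [hE]
    rw [norm_smul, norm_inv, inv_mul_lt_iff₀ h5]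
    have : |Cb| / ε < ‖w + s‖ := by linarith
    rw [div_lt_iff₀ hεp] at this
    linarith
  have hne : ∀ w ∈ Metric.closedBall w0 r, F (w, E w) ≠ 0 := by
    intro w hw
    obtain ⟨h1, h2, h3⟩ := hball w hw
    have h5 : 0 < ‖w + s‖ := lt_of_le_of_lt (by positivity) h3
    have := det_scale_aux (w + s) (norm_pos_iff.1 h5) _ _ (hst (w + s) (by simpa [hsre] using h2))
    rw [hexps] at this
    exact this
  have hdiff : ∀ w ∈ Metric.closedBall w0 r, DifferentiableAt ℂ (fun w => (F (w, E w))⁻¹) w := by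
    intro w hw
    obtain ⟨h1, h2, h3⟩ := hball w hw
    have h5 : 0 < ‖w + s‖ := lt_of_le_of_lt (by positivity) h3
    have h6 := norm_pos_iff.1 h5
    refine DifferentiableAt.fun_inv ?_ (hne w hw)
    refine det_diff_aux _ w fun i j => ?_
    simp only [hE, Matrix.sub_apply, Matrix.smul_apply, smul_eq_mul]
    have h7 : DifferentiableAt ℂ (fun w => Q (w + s) i j) w :=
      ((hQd i j) (w + s)).comp w (f := fun w => w + s) (by fun_prop)
    have h8 : DifferentiableAt ℂ (fun w => (w + s)⁻¹) w :=
      DifferentiableAt.fun_inv (by fun_prop) h6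
    exact DifferentiableAt.fun_sub (by fun_prop) (h8.fun_mul h7)
  have hdc : DiffContOnCl ℂ (fun w => (F (w, E w))⁻¹) (Metric.ball w0 r) := by
    apply DifferentiableOn.diffContOnCl
    rw [closure_ball w0 hr.ne']
    exact fun w hw => (hdiff w hw).differentiableWithinAt
  have hmax := Complex.norm_le_of_forall_mem_frontier_norm_le Metric.isBounded_ball hdc
    (C := m⁻¹) (by
      intro w hw
      rw [frontier_ball w0 hr.ne'] at hw
      have h1 := hb1 w hw (E w) (by
        rw [dist_zero_right]
        exact (hEn w (Metric.sphere_subset_closedBall hw)).trans_le (min_le_left _ _))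
      rw [norm_inv]
      apply inv_anti₀ hm
      linarith) (subset_closure (Metric.mem_ball_self hr) : w0 ∈ _)
  have hc := Metric.mem_closedBall_self (x := w0) hr.le
  have h2 := hb2 (E w0) (by
    rw [dist_zero_right]
    exact (hEn w0 hc).trans_le (min_le_right _ _))
  rw [norm_inv] at hmax
  have h3 : 0 < ‖F (w0, E w0)‖ := norm_pos_iff.2 (hne w0 hc)
  have := (inv_le_inv₀ h3 hm).1 hmax
  linarith

lemma filt_aux {N : Type*} [Fintype N] [DecidableEq N] (D : Matrix N N ℂ)
    (Q : ℂ → Matrix N N ℂ) (hQd : ∀ i j, Differentiable ℂ (fun w => Q w i j)) (Cb : ℝ)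
    (hQb : ∀ w : ℂ, -1 ≤ w.re → ‖Q w‖ ≤ Cb) (t : ℝ) (ht : 0 < t) (δ : ℝ) (hδ : 0 < δ)
    (hst : ∀ w : ℂ, -δ < w.re →
      (w • ((1 : Matrix N N ℂ) - Complex.exp (-w * (t : ℂ)) • D) - Q w).det ≠ 0) :
    ∃ That : ℝ, 0 < That ∧ ∀ T : ℝ, 0 < T → T < That → ∀ w : ℂ, 0 ≤ w.re →
      (w • ((1 : Matrix N N ℂ) - (Complex.exp (-w * (t : ℂ)) * (w * (T : ℂ) + 1)⁻¹) • D)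
        - Q w).det ≠ 0 := by
  have hch := chain_aux D Q hQd Cb hQb t ht δ hδ hst
  have hQc : Continuous Q := continuous_matrix fun i j => (hQd i j).continuous
  have hc1 : Continuous fun x : ℂ × Matrix N N ℂ => ((1 : Matrix N N ℂ) - x.1 • D - x.2).det :=
    Continuous.matrix_det (by fun_prop)
  obtain ⟨ε, hε, h1⟩ := tube_aux (isCompact_closedBall (0 : ℂ) 1)
    (fun x : ℂ × Matrix N N ℂ => ‖((1 : Matrix N N ℂ) - x.1 • D - x.2).det‖)
    (0 : Matrix N N ℂ) (fun x _ => hc1.norm.continuousAt) (fun x hx => by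
      rw [sub_zero]
      exact norm_pos_iff.2 (hch x (by simpa using hx)))
  set L : ℝ := |Cb| / ε + 1 with hL
  have hLp : 0 < L := by positivity
  have hScl : IsCompact (Metric.closedBall (0 : ℂ) L ∩ {w : ℂ | 0 ≤ w.re}) :=
    (isCompact_closedBall _ _).inter_right (isClosed_le continuous_const Complex.continuous_re)
  have hc2 : Continuous fun x : ℂ × ℂ =>
      (x.1 • ((1 : Matrix N N ℂ) - (Complex.exp (-x.1 * (t : ℂ)) * x.2) • D) - Q x.1).det :=
    Continuous.matrix_det (by fun_prop)
  obtain ⟨η, hη, h2⟩ := tube_aux hScl (fun x : ℂ × ℂ =>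
      ‖(x.1 • ((1 : Matrix N N ℂ) - (Complex.exp (-x.1 * (t : ℂ)) * x.2) • D) - Q x.1).det‖)
    (1 : ℂ) (fun x _ => hc2.norm.continuousAt) (fun x hx => by
      rw [mul_one]
      have : 0 ≤ x.re := hx.2
      exact norm_pos_iff.2 (hst x (by linarith)))
  refine ⟨η / L, by positivity, fun T hT hTT w hw => ?_⟩
  have hden : 1 ≤ ‖w * (T : ℂ) + 1‖ := by
    refine le_trans ?_ (Complex.re_le_norm _)
    simp only [Complex.add_re, Complex.one_re, Complex.re_mul_ofReal]
    have := mul_nonneg hw hT.le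
    linarith
  have hden0 : w * (T : ℂ) + 1 ≠ 0 := norm_pos_iff.1 (by linarith)
  by_cases hwL : ‖w‖ ≤ L
  · refine norm_pos_iff.1 (h2 w ⟨by simpa using hwL, hw⟩ _ ?_)
    rw [dist_eq_norm]
    have : (w * (T : ℂ) + 1)⁻¹ - 1 = -(w * T) * (w * (T : ℂ) + 1)⁻¹ := by
      field_simp; ring
    rw [this, norm_mul, norm_neg, norm_mul, norm_inv, Complex.norm_real, Real.norm_of_nonneg hT.le]
    rw [lt_div_iff₀ hLp] at hTT
    calc ‖w‖ * T * ‖w * (T : ℂ) + 1‖⁻¹ ≤ L * T * 1 := by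
          gcongr
          exact inv_le_one_of_one_le₀ hden
      _ < η := by linarith
  · push Not at hwL
    have hw0 : 0 < ‖w‖ := hLp.trans hwL
    apply det_scale_aux' w (norm_pos_iff.1 hw0)
    refine norm_pos_iff.1 (h1 (Complex.exp (-w * (t : ℂ)) * (w * (T : ℂ) + 1)⁻¹) ?_ _ ?_)
    · rw [mem_closedBall_zero_iff, norm_mul, norm_inv, Complex.norm_exp]
      have he : Real.exp (-w * (t : ℂ)).re ≤ 1 := by
        rw [Real.exp_le_one_iff, Complex.re_mul_ofReal, Complex.neg_re]
        have := mul_nonneg hw ht.le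
        linarith
      calc _ ≤ (1 : ℝ) * 1 := by
            gcongr
            exact inv_le_one_of_one_le₀ hden
        _ = 1 := one_mul 1
    · rw [dist_zero_right, norm_smul, norm_inv, inv_mul_lt_iff₀ hw0]
      have h4 : ‖Q w‖ ≤ |Cb| := (hQb _ (by linarith)).trans (le_abs_self _)
      have : |Cb| / ε < ‖w‖ := by linarith
      rw [div_lt_iff₀ hε] at this
      linarith

noncomputable def WmAux {n m p q K : ℕ}
    (A0 : Matrix (Fin n) (Fin n) ℝ) (A : Fin K → Matrix (Fin n) (Fin n) ℝ)
    (B : Matrix (Fin n) (Fin m) ℝ) (C : Matrix (Fin p) (Fin n) ℝ)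
    (Kp Kd : Matrix (Fin m) (Fin p) ℝ)
    (Ui : Matrix (Fin m) (Fin q) ℝ) (Vi : Matrix (Fin q) (Fin p) ℝ)
    (x : ℂ × (Fin K → ℂ) × ℂ × Matrix (Fin m) (Fin m) ℂ × Matrix (Fin p) (Fin p) ℂ
      × Matrix (Fin p) (Fin p) ℂ) : Matrix (Fin n ⊕ Fin q) (Fin n ⊕ Fin q) ℂ :=
  Matrix.fromBlocks (cM A0) 0 0 (0 : Matrix (Fin q) (Fin q) ℂ)
    + ∑ k : Fin K, x.2.1 k •
        Matrix.fromBlocks (cM (A k)) 0 0 (0 : Matrix (Fin q) (Fin q) ℂ)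
    + Matrix.fromBlocks (x.1 • (cM B * x.2.2.2.1)) 0 0
        (1 : Matrix (Fin q) (Fin q) ℂ)
      * Matrix.fromBlocks
          (cM Kp + x.2.2.1 • (cM Kd * x.2.2.2.2.1))
          (cM Ui) (cM Vi) (0 : Matrix (Fin q) (Fin q) ℂ)
      * Matrix.fromBlocks (x.2.2.2.2.2 * cM C) 0 0 (1 : Matrix (Fin q) (Fin q) ℂ)

lemma WmAux_cont {n m p q K : ℕ}
    (A0 : Matrix (Fin n) (Fin n) ℝ) (A : Fin K → Matrix (Fin n) (Fin n) ℝ)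
    (B : Matrix (Fin n) (Fin m) ℝ) (C : Matrix (Fin p) (Fin n) ℝ)
    (Kp Kd : Matrix (Fin m) (Fin p) ℝ)
    (Ui : Matrix (Fin m) (Fin q) ℝ) (Vi : Matrix (Fin q) (Fin p) ℝ) :
    Continuous (WmAux A0 A B C Kp Kd Ui Vi) := by
  unfold WmAux
  refine Continuous.add (Continuous.add continuous_const ?_) (Continuous.matrix_mul
    (Continuous.matrix_mul ?_ ?_) ?_)
  · fun_prop
  · exact Continuous.matrix_fromBlocks (by fun_prop) (by fun_prop) (by fun_prop) (by fun_prop)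
  · exact Continuous.matrix_fromBlocks (by fun_prop) (by fun_prop) (by fun_prop) (by fun_prop)
  · exact Continuous.matrix_fromBlocks (by fun_prop) (by fun_prop) (by fun_prop) (by fun_prop)

lemma WmAux_one {n m p q K : ℕ}
    (A0 : Matrix (Fin n) (Fin n) ℝ) (A : Fin K → Matrix (Fin n) (Fin n) ℝ)
    (B : Matrix (Fin n) (Fin m) ℝ) (C : Matrix (Fin p) (Fin n) ℝ)
    (Kp Kd : Matrix (Fin m) (Fin p) ℝ)
    (Ui : Matrix (Fin m) (Fin q) ℝ) (Vi : Matrix (Fin q) (Fin p) ℝ) (e s : ℂ) (ek : Fin K → ℂ) :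
    WmAux A0 A B C Kp Kd Ui Vi (e, ek, s, 1, 1, 1) =
      (e * s) • Matrix.fromBlocks (cM B * cM Kd * cM C) 0 0 (0 : Matrix (Fin q) (Fin q) ℂ) +
      (Matrix.fromBlocks (cM A0) 0 (cM Vi * cM C) (0 : Matrix (Fin q) (Fin q) ℂ)
        + e • Matrix.fromBlocks (cM B * cM Kp * cM C) (cM B * cM Ui) 0
            (0 : Matrix (Fin q) (Fin q) ℂ)
        + ∑ k : Fin K, ek k •
          Matrix.fromBlocks (cM (A k)) 0 0 (0 : Matrix (Fin q) (Fin q) ℂ)) := by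
  unfold WmAux
  have : Matrix.fromBlocks (cM A0) 0 0 (0 : Matrix (Fin q) (Fin q) ℂ) +
      Matrix.fromBlocks (e • (cM B * (1 : Matrix (Fin m) (Fin m) ℂ))) 0 0
        (1 : Matrix (Fin q) (Fin q) ℂ)
      * Matrix.fromBlocks
          (cM Kp + s • (cM Kd * (1 : Matrix (Fin p) (Fin p) ℂ)))
          (cM Ui) (cM Vi) (0 : Matrix (Fin q) (Fin q) ℂ)
      * Matrix.fromBlocks ((1 : Matrix (Fin p) (Fin p) ℂ) * cM C) 0 0
          (1 : Matrix (Fin q) (Fin q) ℂ)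
      = (e * s) • Matrix.fromBlocks (cM B * cM Kd * cM C) 0 0 (0 : Matrix (Fin q) (Fin q) ℂ) +
      (Matrix.fromBlocks (cM A0) 0 (cM Vi * cM C) (0 : Matrix (Fin q) (Fin q) ℂ)
        + e • Matrix.fromBlocks (cM B * cM Kp * cM C) (cM B * cM Ui) 0
            (0 : Matrix (Fin q) (Fin q) ℂ)) := by
    simp only [Matrix.fromBlocks_multiply, Matrix.fromBlocks_add, Matrix.fromBlocks_smul,
      Matrix.mul_one, Matrix.one_mul, Matrix.mul_zero, Matrix.zero_mul, add_zero, zero_add,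
      smul_zero, Matrix.mul_add, Matrix.add_mul, Matrix.smul_mul, Matrix.mul_smul, smul_add,
      smul_smul]
    congr 1
    rw [mul_comm s e]
    abel
  simp only
  rw [add_right_comm, this]
  abel

theorem bdd_aux {T : ℝ} (hT : 0 < T) (w : ℂ) (hw : -(1 / (2 * T)) ≤ w.re) :
    ‖w / (w * (T : ℂ) + 1)‖ ≤ 3 / T := by
  have hden : 1 / 2 ≤ ‖w * (T : ℂ) + 1‖ := by
    refine le_trans ?_ (Complex.re_le_norm _)
    simp only [Complex.add_re, Complex.one_re, Complex.re_mul_ofReal]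
    have h1 := mul_le_mul_of_nonneg_right hw hT.le
    have h2 : -(1 / (2 * T)) * T = -(1 / 2) := by field_simp
    linarith
  have hd0 : 0 < ‖w * (T : ℂ) + 1‖ := by linarith
  rw [norm_div, div_le_div_iff₀ hd0 hT]
  have h3 : ‖w‖ * T = ‖(w * (T : ℂ) + 1) - 1‖ := by
    rw [add_sub_cancel_right, norm_mul, Complex.norm_real, Real.norm_of_nonneg hT.le]
  rw [h3]
  refine (norm_sub_le _ _).trans ?_
  rw [norm_one]; linarith

/-- Proposition 6.1: if the input-delayed nominal closed loop is exponentially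
stable, then the closed loop with low-pass filter is strongly stable for all
sufficiently small time constants `T`. -/
theorem stmt11 {n m p q K : ℕ}
    (hn : 0 < n) (hm : 0 < m) (hp : 0 < p) (hK : 0 < K)
    (A0 : Matrix (Fin n) (Fin n) ℝ) (A : Fin K → Matrix (Fin n) (Fin n) ℝ)
    (τ : Fin K → ℝ) (hτpos : ∀ k, 0 < τ k) (hτmono : StrictMono τ)
    (τu : ℝ) (hτu : 0 < τu)
    (B : Matrix (Fin n) (Fin m) ℝ) (hB : B.rank = m)
    (C : Matrix (Fin p) (Fin n) ℝ) (hC : C.rank = p)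
    (Kp Kd Ki : Matrix (Fin m) (Fin p) ℝ)
    (Ui : Matrix (Fin m) (Fin q) ℝ) (Vi : Matrix (Fin q) (Fin p) ℝ)
    (hfact : Ki = Ui * Vi) (hUi : Ui.rank = q) (hVi : Vi.rank = q) (hKi : Ki.rank = q)
    (hstab : ∃ δ : ℝ, 0 < δ ∧ ∀ lam : ℂ,
      Htau A0 A τ τu B C Kp Kd Ui Vi lam = 0 → lam.re ≤ -δ) :
    ∃ That : ℝ, 0 < That ∧ ∀ T : ℝ, 0 < T → T < That →
      ∀ (R1 : ℂ → ℝ → Matrix (Fin m) (Fin m) ℂ)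
        (R2 R3 : ℂ → ℝ → Matrix (Fin p) (Fin p) ℂ),
        Admissible m R1 → Admissible p R2 → Admissible p R3 →
        (∀ (lam : ℂ) (r : ℝ), 0 ≤ r → IsUnit (R1 lam r)) →
        (∀ (lam : ℂ) (r : ℝ), 0 ≤ r → IsUnit (R3 lam r)) →
        ∃ rhat c : ℝ, 0 < rhat ∧ 0 < c ∧
          ∀ r1 r2 r3 : ℝ, 0 < r1 → r1 < rhat → 0 < r2 → r2 < rhat → 0 < r3 → r3 < rhat →
            ∀ lam : ℂ, -c < lam.re →
              H6 A0 A τ τu B C Kp Kd Ui Vi R1 R2 R3 lam T r1 r2 r3 ≠ 0 := by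
  obtain ⟨δ, hδ, hst⟩ := hstab
  set D : Matrix (Fin n ⊕ Fin q) (Fin n ⊕ Fin q) ℂ :=
    Matrix.fromBlocks (cM B * cM Kd * cM C) 0 0 (0 : Matrix (Fin q) (Fin q) ℂ) with hD
  set Q : ℂ → Matrix (Fin n ⊕ Fin q) (Fin n ⊕ Fin q) ℂ := fun w =>
    Matrix.fromBlocks (cM A0) 0 (cM Vi * cM C) (0 : Matrix (Fin q) (Fin q) ℂ)
        + Complex.exp (-w * (τu : ℂ)) • Matrix.fromBlocks (cM B * cM Kp * cM C) (cM B * cM Ui) 0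
            (0 : Matrix (Fin q) (Fin q) ℂ)
        + ∑ k : Fin K, Complex.exp (-w * (τ k : ℂ)) •
          Matrix.fromBlocks (cM (A k)) 0 0 (0 : Matrix (Fin q) (Fin q) ℂ) with hQ
  set W := WmAux A0 A B C Kp Kd Ui Vi with hW
  have hWc : Continuous W := WmAux_cont A0 A B C Kp Kd Ui Vi
  haveI : ProperSpace (Matrix (Fin m) (Fin m) ℂ) :=
    inferInstanceAs (ProperSpace (Fin m → Fin m → ℂ))
  haveI : ProperSpace (Matrix (Fin p) (Fin p) ℂ) :=
    inferInstanceAs (ProperSpace (Fin p → Fin p → ℂ))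
  -- bounds on exponentials
  set Be : ℝ := Real.exp τu + ∑ k, Real.exp (τ k) with hBe
  have hBe0 : 0 ≤ Be := by positivity
  have hexpb : ∀ (t : ℝ), 0 < t → ∀ w : ℂ, -1 ≤ w.re →
      ‖Complex.exp (-w * (t : ℂ))‖ ≤ Real.exp t := by
    intro t ht w hw
    rw [Complex.norm_exp, Real.exp_le_exp, Complex.re_mul_ofReal, Complex.neg_re]
    nlinarith
  have hbe : ∀ w : ℂ, -1 ≤ w.re → ‖Complex.exp (-w * (τu : ℂ))‖ ≤ Be := by
    intro w hw
    refine (hexpb τu hτu w hw).trans ?_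
    have : 0 ≤ ∑ k, Real.exp (τ k) := by positivity
    linarith
  have hbek : ∀ w : ℂ, -1 ≤ w.re →
      ‖(fun k : Fin K => Complex.exp (-w * (τ k : ℂ)))‖ ≤ Be := by
    intro w hw
    rw [pi_norm_le_iff_of_nonneg hBe0]
    intro k
    refine (hexpb (τ k) (hτpos k) w hw).trans ?_
    have h1 : Real.exp (τ k) ≤ ∑ k, Real.exp (τ k) :=
      Finset.single_le_sum (f := fun k => Real.exp (τ k)) (fun i _ => (Real.exp_pos _).le)
        (Finset.mem_univ k)
    have := Real.exp_pos τu
    linarith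
  have hWb : ∀ ρ : ℝ, ∃ c : ℝ, ∀ e ek s X1 X2 X3, ‖e‖ ≤ ρ → ‖ek‖ ≤ ρ → ‖s‖ ≤ ρ → ‖X1‖ ≤ ρ →
      ‖X2‖ ≤ ρ → ‖X3‖ ≤ ρ → ‖W (e, ek, s, X1, X2, X3)‖ ≤ c := by
    intro ρ
    obtain ⟨c, hc⟩ := (isCompact_closedBall (0 : ℂ × (Fin K → ℂ) × ℂ ×
      Matrix (Fin m) (Fin m) ℂ × Matrix (Fin p) (Fin p) ℂ
      × Matrix (Fin p) (Fin p) ℂ) ρ).exists_bound_of_continuousOn hWc.continuousOn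
    refine ⟨c, fun e ek s X1 X2 X3 h1 h2 h3 h4 h5 h6 => hc _ ?_⟩
    rw [mem_closedBall_zero_iff]
    simp only [norm_prod_le_iff]
    exact ⟨h1, h2, h3, h4, h5, h6⟩
  have hone : ∀ w s : ℂ, W (Complex.exp (-w * (τu : ℂ)),
      (fun k : Fin K => Complex.exp (-w * (τ k : ℂ))), s, 1, 1, 1)
      = (Complex.exp (-w * (τu : ℂ)) * s) • D + Q w := fun w s => WmAux_one _ _ _ _ _ _ _ _ _ _ _
  obtain ⟨Cb, hCb⟩ : ∃ Cb : ℝ, ∀ w : ℂ, -1 ≤ w.re → ‖Q w‖ ≤ Cb := by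
    obtain ⟨c, hc⟩ := hWb (Be + ‖(1 : Matrix (Fin m) (Fin m) ℂ)‖
      + ‖(1 : Matrix (Fin p) (Fin p) ℂ)‖)
    have n1 := norm_nonneg (1 : Matrix (Fin m) (Fin m) ℂ)
    have n2 := norm_nonneg (1 : Matrix (Fin p) (Fin p) ℂ)
    refine ⟨c, fun w hw => ?_⟩
    have := hone w 0
    rw [mul_zero, zero_smul, zero_add] at this
    rw [← this]
    have := hbe w hw
    have := hbek w hw
    apply hc
    all_goals first | linarith | (rw [norm_zero]; linarith)
  have hQd : ∀ i j, Differentiable ℂ (fun w => Q w i j) := by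
    intro i j
    simp only [hQ, Matrix.add_apply, Matrix.smul_apply, Matrix.sum_apply, smul_eq_mul]
    fun_prop
  obtain ⟨That, hThat, hfilt⟩ := filt_aux D Q hQd Cb hCb τu hτu δ hδ (by
    intro w hw h0
    have : Htau A0 A τ τu B C Kp Kd Ui Vi w = 0 := by
      rw [← h0]
      unfold Htau
      congr 1
      simp only [hQ, hD]
      abel
    have := hst w this
    linarith)
  refine ⟨That, hThat, fun T hT hTT R1 R2 R3 hR1 hR2 hR3 _ _ => ?_⟩
  have hH6 : ∀ w r1 r2 r3, H6 A0 A τ τu B C Kp Kd Ui Vi R1 R2 R3 w T r1 r2 r3 =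
      (w • (1 : Matrix (Fin n ⊕ Fin q) (Fin n ⊕ Fin q) ℂ) - W (Complex.exp (-w * (τu : ℂ)),
      (fun k : Fin K => Complex.exp (-w * (τ k : ℂ))), w / (w * (T : ℂ) + 1),
        R1 w r1, R2 w r2, R3 w r3)).det := by
    intro w r1 r2 r3
    unfold H6
    simp only [hW, WmAux]
    congr 1
    abel
  obtain ⟨M1, N1, ρ1, hM1, hN1, hρ1, hb1⟩ := hR1.bounded
  obtain ⟨M2, N2, ρ2, hM2, hN2, hρ2, hb2⟩ := hR2.bounded
  obtain ⟨M3, N3, ρ3, hM3, hN3, hρ3, hb3⟩ := hR3.bounded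
  have h3T : 0 < 3 / T := by positivity
  obtain ⟨Cw, hCw⟩ := hWb (Be + 3 / T + M1 + M2 + M3)
  -- large frequencies
  obtain ⟨ε, hε, hlarge⟩ := tube_aux (isCompact_singleton (x := (0 : ℂ)))
    (fun x : ℂ × Matrix (Fin n ⊕ Fin q) (Fin n ⊕ Fin q) ℂ =>
      ‖((1 : Matrix (Fin n ⊕ Fin q) (Fin n ⊕ Fin q) ℂ) - x.2).det‖) 0
    (fun x _ => (Continuous.norm (Continuous.matrix_det (by fun_prop))).continuousAt)
    (fun x _ => by simp)
  have hlarge := hlarge 0 rfl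
  set L : ℝ := |Cw| / ε + 1 with hL
  have hLp : 0 < L := by positivity
  have hScl : IsCompact (Metric.closedBall (0 : ℂ) L ∩ {w : ℂ | 0 ≤ w.re}) :=
    (isCompact_closedBall _ _).inter_right (isClosed_le continuous_const Complex.continuous_re)
  have hcG : Continuous fun x : ℂ × ℂ × Matrix (Fin m) (Fin m) ℂ × Matrix (Fin p) (Fin p) ℂ
      × Matrix (Fin p) (Fin p) ℂ =>
      (x.1 • (1 : Matrix (Fin n ⊕ Fin q) (Fin n ⊕ Fin q) ℂ) - W (Complex.exp (-x.1 * (τu : ℂ)),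
      (fun k : Fin K => Complex.exp (-x.1 * (τ k : ℂ))), x.2.1, x.2.2.1, x.2.2.2.1,
        x.2.2.2.2)).det := by
    refine Continuous.matrix_det (Continuous.sub (by fun_prop) (hWc.comp ?_))
    fun_prop
  obtain ⟨η, hη, hsmall⟩ := tube_aux hScl
    (fun x : ℂ × ℝ × Matrix (Fin m) (Fin m) ℂ × Matrix (Fin p) (Fin p) ℂ
      × Matrix (Fin p) (Fin p) ℂ =>
      ‖((x.1 - (x.2.1 : ℂ)) • (1 : Matrix (Fin n ⊕ Fin q) (Fin n ⊕ Fin q) ℂ) -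
        W (Complex.exp (-(x.1 - (x.2.1 : ℂ)) * (τu : ℂ)),
      (fun k : Fin K => Complex.exp (-(x.1 - (x.2.1 : ℂ)) * (τ k : ℂ))),
      (x.1 - (x.2.1 : ℂ)) / ((x.1 - (x.2.1 : ℂ)) * (T : ℂ) + 1), x.2.2.1, x.2.2.2.1,
        x.2.2.2.2)).det‖) (0, 1, 1, 1)
    (by
      intro w hw
      have hw : 0 ≤ w.re := hw.2
      have hden0 : (w - ((0 : ℝ) : ℂ)) * (T : ℂ) + 1 ≠ 0 := by
        intro h
        have := congrArg Complex.re h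
        simp only [Complex.ofReal_zero, sub_zero, Complex.add_re, Complex.one_re,
          Complex.re_mul_ofReal, Complex.zero_re] at this
        have := mul_nonneg hw hT.le
        linarith
      refine ContinuousAt.norm ?_
      refine ContinuousAt.comp (f := fun x : ℂ × ℝ × Matrix (Fin m) (Fin m) ℂ ×
        Matrix (Fin p) (Fin p) ℂ × Matrix (Fin p) (Fin p) ℂ => ((x.1 - (x.2.1 : ℂ)),
        (x.1 - (x.2.1 : ℂ)) / ((x.1 - (x.2.1 : ℂ)) * (T : ℂ) + 1), x.2.2.1, x.2.2.2.1,
        x.2.2.2.2)) hcG.continuousAt ?_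
      refine ContinuousAt.prodMk (by fun_prop) (ContinuousAt.prodMk ?_ (by fun_prop))
      exact ContinuousAt.div (by fun_prop) (by fun_prop) hden0)
    (by
      intro w hw
      refine norm_pos_iff.2 ?_
      have h1 := hfilt T hT hTT w hw.2
      simp only [Complex.ofReal_zero, sub_zero]
      rw [hone]
      convert h1 using 2
      rw [smul_sub, smul_smul, ← sub_sub]
      congr 3
      ring)
  obtain ⟨d1, hd1, hu1⟩ := hR1.unif_conv (Metric.closedBall 0 L) (isCompact_closedBall _ _)
    (η / 2) (by positivity)
  obtain ⟨d2, hd2, hu2⟩ := hR2.unif_conv (Metric.closedBall 0 L) (isCompact_closedBall _ _)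
    (η / 2) (by positivity)
  obtain ⟨d3, hd3, hu3⟩ := hR3.unif_conv (Metric.closedBall 0 L) (isCompact_closedBall _ _)
    (η / 2) (by positivity)
  obtain ⟨rhat, hr, hrρ1, hrρ2, hrρ3, hrd1, hrd2, hrd3⟩ : ∃ r : ℝ, 0 < r ∧ r ≤ ρ1 ∧ r ≤ ρ2 ∧
      r ≤ ρ3 ∧ r ≤ d1 ∧ r ≤ d2 ∧ r ≤ d3 := by
    refine ⟨min ρ1 (min ρ2 (min ρ3 (min d1 (min d2 d3)))), by positivity, ?_⟩
    simp
  obtain ⟨c, hc, hc1, hcT, hcN1, hcN2, hcN3, hcη⟩ : ∃ c : ℝ, 0 < c ∧ c ≤ 1 ∧ c ≤ 1 / (2 * T) ∧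
      c ≤ N1 ∧ c ≤ N2 ∧ c ≤ N3 ∧ c ≤ η := by
    refine ⟨min 1 (min (1 / (2 * T)) (min N1 (min N2 (min N3 η)))), by positivity, ?_⟩
    simp
  refine ⟨rhat, c, hr, hc, fun r1 r2 r3 h10 h1 h20 h2 h30 h3 w hw => ?_⟩
  rw [hH6]
  by_cases hwL : ‖w‖ ≤ L
  · have hwB : w ∈ Metric.closedBall (0 : ℂ) L := by simpa using hwL
    have e1 := hu1 r1 h10 (by linarith) w hwB
    have e2 := hu2 r2 h20 (by linarith) w hwB
    have e3 := hu3 r3 h30 (by linarith) w hwB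
    obtain ⟨w', t, hw', ht0, htc, hww⟩ : ∃ (w' : ℂ) (t : ℝ),
        w' ∈ Metric.closedBall (0 : ℂ) L ∩ {w : ℂ | 0 ≤ w.re} ∧ 0 ≤ t ∧ t < c ∧ w = w' - t := by
      by_cases hre : 0 ≤ w.re
      · exact ⟨w, 0, ⟨hwB, hre⟩, le_rfl, hc, by simp⟩
      · push Not at hre
        refine ⟨(w.im : ℂ) * Complex.I, -w.re, ⟨?_, ?_⟩, by linarith, by linarith, ?_⟩
        · rw [mem_closedBall_zero_iff, norm_mul, Complex.norm_I, mul_one, Complex.norm_real]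
          exact (Complex.abs_im_le_norm w).trans hwL
        · simp
        · apply Complex.ext <;> simp
    have := hsmall w' hw' (t, R1 w r1, R2 w r2, R3 w r3) (by
      simp only [Prod.dist_eq, max_lt_iff]
      simp only [dist_eq_norm]
      refine ⟨?_, by linarith, by linarith, by linarith⟩
      rw [sub_zero, Real.norm_of_nonneg ht0]
      linarith)
    simp only [← hww] at this
    exact norm_pos_iff.1 this
  · push Not at hwL
    have hw0 : 0 < ‖w‖ := hLp.trans hwL
    apply det_scale_aux' w (norm_pos_iff.1 hw0)
    refine norm_pos_iff.1 (hlarge _ ?_)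
    have b1 := hb1 w (by linarith) r1 h10 (by linarith)
    have b2 := hb2 w (by linarith) r2 h20 (by linarith)
    have b3 := hb3 w (by linarith) r3 h30 (by linarith)
    have b4 := hbe w (by linarith)
    have b5 := hbek w (by linarith)
    have b6 := bdd_aux hT w (by linarith)
    have b7 := hCw _ _ _ _ _ _ (show ‖Complex.exp (-w * (τu : ℂ))‖ ≤ _ by linarith)
      (show ‖(fun k : Fin K => Complex.exp (-w * (τ k : ℂ)))‖ ≤ _ by linarith)
      (show ‖w / (w * (T : ℂ) + 1)‖ ≤ _ by linarith) (show ‖R1 w r1‖ ≤ _ by linarith)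
      (show ‖R2 w r2‖ ≤ _ by linarith) (show ‖R3 w r3‖ ≤ _ by linarith)
    rw [dist_zero_right, norm_smul, norm_inv, inv_mul_lt_iff₀ hw0]
    have h4 := b7.trans (le_abs_self _)
    have : |Cw| / ε < ‖w‖ := by linarith
    rw [div_lt_iff₀ hε] at this
    linarith
end

section
/- Let k_p, k_d ∈ ℝ with k_d ≠ 1, and consider the polynomial p(λ) = (1 − k_d)λ³ + (1 − k_p)λ² − (k_d + 1/3)λ − (k_p + 1). Then every complex root of p has strictly negative real part if and only if either (k_d < 1 and k_p < −1 and k_d < 1/3 + (2/3)k_p) or (k_d > 1 and k_p > 1 and k_d < 1/3 + (2/3)k_p). -/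
lemma aux_root (B C D : ℝ) : ∃ r : ℝ, r ^ 3 + B * r ^ 2 + C * r + D = 0 := by
  set M := 1 + |B| + |C| + |D| with hM
  have hB := abs_nonneg B
  have hC := abs_nonneg C
  have hD := abs_nonneg D
  have hM1 : 1 ≤ M := by linarith
  have hM2 : M ≤ M ^ 2 := by nlinarith
  have key : |B| * M ^ 2 + |C| * M + |D| < M ^ 3 := by
    have h1 : |C| * M ≤ |C| * M ^ 2 := mul_le_mul_of_nonneg_left hM2 hC
    have h2 : |D| * 1 ≤ |D| * M ^ 2 := mul_le_mul_of_nonneg_left (by linarith) hD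
    have h3 : M ^ 3 = M ^ 2 + |B| * M ^ 2 + |C| * M ^ 2 + |D| * M ^ 2 := by
      rw [show M ^ 3 = M * M ^ 2 by ring]
      nth_rewrite 1 [hM]
      ring
    linarith
  have b1 : |B * M ^ 2| = |B| * M ^ 2 := by rw [abs_mul, abs_of_nonneg (by positivity : 0 ≤ M ^ 2)]
  have c1 : |C * M| = |C| * M := by rw [abs_mul, abs_of_nonneg (by linarith : 0 ≤ M)]
  have b2 := abs_le.mp b1.le
  have c2 := abs_le.mp c1.le
  have d2 := abs_le.mp (le_refl |D|)
  have hc : ContinuousOn (fun r : ℝ => r ^ 3 + B * r ^ 2 + C * r + D) (Set.Icc (-M) M) := by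
    fun_prop
  have := intermediate_value_Icc (by linarith : -M ≤ M) hc
  obtain ⟨r, _, hr⟩ := this (show (0 : ℝ) ∈ _ by
    constructor
    · have : (-M) ^ 3 + B * (-M) ^ 2 + C * (-M) + D = - M ^ 3 + B * M ^ 2 - C * M + D := by ring
      simp only [this]
      linarith [b2.2, c2.1, d2.2]
    · show 0 ≤ M ^ 3 + B * M ^ 2 + C * M + D
      linarith [b2.1, c2.1, d2.1])
  exact ⟨r, hr⟩

lemma aux_quad (p q : ℝ) (h : ∀ z : ℂ, z ^ 2 + p * z + q = 0 → z.re < 0) : 0 < p ∧ 0 < q := by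
  by_cases hd : 0 ≤ p ^ 2 - 4 * q
  · have hs := Real.sq_sqrt hd
    have hs0 := Real.sqrt_nonneg (p ^ 2 - 4 * q)
    set s := Real.sqrt (p ^ 2 - 4 * q)
    have := h (((-p + s) / 2 : ℝ) : ℂ) (by
      norm_cast
      nlinarith)
    rw [Complex.ofReal_re] at this
    constructor
    · linarith
    · nlinarith
  · have hd' : 0 ≤ 4 * q - p ^ 2 := by linarith
    have hs := Real.sq_sqrt hd'
    set s := Real.sqrt (4 * q - p ^ 2)
    have := h ⟨-p / 2, s / 2⟩ (by
      apply Complex.ext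
      · simp [pow_two]
        nlinarith
      · simp [pow_two]
        ring)
    simp only at this
    constructor
    · linarith
    · nlinarith [sq_nonneg p]

lemma aux_quad' (p q : ℝ) (hp : 0 < p) (hq : 0 < q) (z : ℂ) (h : z ^ 2 + p * z + q = 0) :
    z.re < 0 := by
  have h1 := congrArg Complex.re h
  have h2 := congrArg Complex.im h
  simp [pow_two] at h1 h2
  by_contra hz
  push Not at hz
  have h3 : z.im * (2 * z.re + p) = 0 := by linarith
  rcases mul_eq_zero.mp h3 with h4 | h4
  · rw [h4] at h1
    nlinarith [mul_nonneg hp.le hz]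
  · linarith

lemma aux_cubic (B C D : ℝ) :
    (∀ z : ℂ, z ^ 3 + B * z ^ 2 + C * z + D = 0 → z.re < 0) ↔ (0 < B ∧ 0 < D ∧ D < B * C) := by
  obtain ⟨r, hr⟩ := aux_root B C D
  obtain ⟨p, rfl⟩ : ∃ p, B = p - r := ⟨B + r, by ring⟩
  obtain ⟨q, rfl⟩ : ∃ q, C = q - p * r := ⟨C + p * r, by ring⟩
  obtain rfl : D = -(r * q) := by linarith
  have fac : ∀ z : ℂ, z ^ 3 + ((p - r : ℝ) : ℂ) * z ^ 2 + ((q - p * r : ℝ) : ℂ) * z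
      + ((-(r * q) : ℝ) : ℂ) = (z - r) * (z ^ 2 + p * z + q) := by
    intro z
    push_cast
    ring
  simp only [fac]
  constructor
  · intro h
    have h1 : r < 0 := by simpa using h (r : ℂ) (by simp)
    obtain ⟨hp, hq⟩ := aux_quad p q (fun z hz => h z (by rw [hz, mul_zero]))
    have e1 : 0 < -r * q := mul_pos (by linarith) hq
    have e2 : 0 < -r * p := mul_pos (by linarith) hp
    refine ⟨by linarith, by linarith, ?_⟩
    have : 0 < p * (q + -r * p + r ^ 2) := by positivity
    linarith
  · rintro ⟨hB, hD, hBC⟩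
    have hC : 0 < q - p * r := by
      by_contra hc
      push Not at hc
      nlinarith
    have h1 : r < 0 := by
      by_contra hc
      push Not at hc
      have a1 : 0 ≤ (p - r) * r ^ 2 := by positivity
      have a2 : 0 ≤ (q - p * r) * r := by positivity
      have a3 : 0 ≤ r ^ 3 := by positivity
      linarith
    have hq : 0 < q := by
      by_contra hc
      push Not at hc
      nlinarith
    have hp : 0 < p := by
      have e : 0 < p * ((q - p * r) + r ^ 2) := by linarith
      exact pos_of_mul_pos_left e (by positivity)
    intro z hz
    rcases mul_eq_zero.mp hz with h | h
    · rw [sub_eq_zero.mp h]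
      simpa using h1
    · exact aux_quad' p q hp hq z h

/-- Stability region of the third-order plant under PD output feedback:
all complex roots of `(1−k_d)λ³ + (1−k_p)λ² − (k_d+1/3)λ − (k_p+1)` have
strictly negative real part iff
`(k_d < 1 ∧ k_p < −1 ∧ k_d < 1/3 + (2/3)k_p)` or
`(k_d > 1 ∧ k_p > 1 ∧ k_d < 1/3 + (2/3)k_p)`. -/
theorem stmt13 (kp kd : ℝ) (hkd : kd ≠ 1) :
    (∀ lam : ℂ,
      ((1 - kd : ℝ) : ℂ) * lam ^ 3 + ((1 - kp : ℝ) : ℂ) * lam ^ 2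
        - ((kd + 1/3 : ℝ) : ℂ) * lam - ((kp + 1 : ℝ) : ℂ) = 0 → lam.re < 0)
    ↔ ((kd < 1 ∧ kp < -1 ∧ kd < 1/3 + (2/3) * kp) ∨
       (kd > 1 ∧ kp > 1 ∧ kd < 1/3 + (2/3) * kp)) := by
  have ha : 1 - kd ≠ 0 := sub_ne_zero.mpr (Ne.symm hkd)
  have haC : ((1 - kd : ℝ) : ℂ) ≠ 0 := by exact_mod_cast ha
  have key := aux_cubic ((1 - kp) / (1 - kd)) (-(kd + 1/3) / (1 - kd)) (-(kp + 1) / (1 - kd))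
  have e : ∀ z : ℂ, (((1 - kd : ℝ) : ℂ) * z ^ 3 + ((1 - kp : ℝ) : ℂ) * z ^ 2
        - ((kd + 1/3 : ℝ) : ℂ) * z - ((kp + 1 : ℝ) : ℂ) = 0) ↔
      z ^ 3 + (((1 - kp) / (1 - kd) : ℝ) : ℂ) * z ^ 2 + ((-(kd + 1/3) / (1 - kd) : ℝ) : ℂ) * z
        + ((-(kp + 1) / (1 - kd) : ℝ) : ℂ) = 0 := by
    intro z
    have : ((1 - kd : ℝ) : ℂ) * z ^ 3 + ((1 - kp : ℝ) : ℂ) * z ^ 2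
        - ((kd + 1/3 : ℝ) : ℂ) * z - ((kp + 1 : ℝ) : ℂ) = ((1 - kd : ℝ) : ℂ) *
      (z ^ 3 + (((1 - kp) / (1 - kd) : ℝ) : ℂ) * z ^ 2 + ((-(kd + 1/3) / (1 - kd) : ℝ) : ℂ) * z
        + ((-(kp + 1) / (1 - kd) : ℝ) : ℂ)) := by
      rw [Complex.ofReal_div, Complex.ofReal_div, Complex.ofReal_div, Complex.ofReal_neg,
        Complex.ofReal_neg]
      field_simp
      ring
    rw [this, mul_eq_zero, or_iff_right haC]
  simp only [e]
  rw [key]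
  have e3 : (1 - kp) / (1 - kd) * (-(kd + 1/3) / (1 - kd)) - -(kp + 1) / (1 - kd)
      = (2 * (1/3 + (2/3) * kp - kd)) / (1 - kd) ^ 2 := by
    field_simp
    ring
  have e4 : -(kp + 1) / (1 - kd) < (1 - kp) / (1 - kd) * (-(kd + 1/3) / (1 - kd)) ↔
      kd < 1/3 + (2/3) * kp := by
    rw [← sub_pos, e3, div_pos_iff_of_pos_right (by positivity)]
    constructor <;> intro h <;> linarith
  rw [e4, div_pos_iff, div_pos_iff]
  constructor
  · rintro ⟨h1 | h1, h2 | h2, h3⟩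
    · left; refine ⟨?_, ?_, h3⟩ <;> linarith
    · linarith
    · linarith
    · right; refine ⟨?_, ?_, h3⟩ <;> linarith
  · rintro (⟨h1, h2, h3⟩ | ⟨h1, h2, h3⟩)
    · refine ⟨Or.inl ⟨?_, ?_⟩, Or.inl ⟨?_, ?_⟩, h3⟩ <;> linarith
    · refine ⟨Or.inr ⟨?_, ?_⟩, Or.inr ⟨?_, ?_⟩, h3⟩ <;> linarith
end

section
/- Let k_p, k_d ∈ ℝ and let ω ∈ ℝ with ω ≠ 0, and consider the polynomial p(λ) = (1 − k_d)λ³ + (1 − k_p)λ² − (k_d + 1/3)λ − (k_p + 1). Then p(iω) = 0 if and only if (k_p < −1 or k_p > 1), k_d = 1/3 + (2/3)k_p, and ω² = (−k_p − 1)/(1 − k_p). Moreover, for every k_d ∈ ℝ, p(0) = 0 if and only if k_p = −1. -/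
/-- Imaginary-axis roots of the closed-loop polynomial
`p(λ) = (1−k_d)λ³ + (1−k_p)λ² − (k_d+1/3)λ − (k_p+1)` of the third-order plant
under PD feedback: for `ω ≠ 0`, `p(iω) = 0` iff `(k_p < −1 ∨ k_p > 1)`,
`k_d = 1/3 + (2/3)k_p` and `ω² = (−k_p−1)/(1−k_p)`; moreover, for every `k_d`,
`p(0) = 0` iff `k_p = −1`. -/
theorem stmt14 (kp kd ω : ℝ) (hω : ω ≠ 0) :
    (((1 - kd : ℝ) : ℂ) * (Complex.I * ω) ^ 3 + ((1 - kp : ℝ) : ℂ) * (Complex.I * ω) ^ 2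
        - ((kd + 1/3 : ℝ) : ℂ) * (Complex.I * ω) - ((kp + 1 : ℝ) : ℂ) = 0
      ↔ ((kp < -1 ∨ kp > 1) ∧ kd = 1/3 + (2/3) * kp ∧ ω ^ 2 = (-kp - 1) / (1 - kp)))
    ∧ (∀ kd' : ℝ,
        (((1 - kd' : ℝ) : ℂ) * (0 : ℂ) ^ 3 + ((1 - kp : ℝ) : ℂ) * (0 : ℂ) ^ 2
          - ((kd' + 1/3 : ℝ) : ℂ) * (0 : ℂ) - ((kp + 1 : ℝ) : ℂ) = 0)
        ↔ kp = -1) := by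
  constructor
  · have key : ((1 - kd : ℝ) : ℂ) * (Complex.I * ω) ^ 3 + ((1 - kp : ℝ) : ℂ) * (Complex.I * ω) ^ 2
        - ((kd + 1/3 : ℝ) : ℂ) * (Complex.I * ω) - ((kp + 1 : ℝ) : ℂ)
        = ((-(1 - kp) * ω ^ 2 - (kp + 1) : ℝ) : ℂ)
          + ((-ω * ((1 - kd) * ω ^ 2 + (kd + 1/3)) : ℝ) : ℂ) * Complex.I := by
      have h3 : Complex.I ^ 3 = -Complex.I := Complex.I_pow_three
      rw [mul_pow, mul_pow, h3, Complex.I_sq]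
      push_cast
      ring
    have hw : 0 < ω ^ 2 := by positivity
    rw [key]
    constructor
    · intro h
      have hre := congrArg Complex.re h
      have him := congrArg Complex.im h
      rw [Complex.add_re, Complex.re_ofReal_mul, Complex.ofReal_re, Complex.I_re,
        Complex.zero_re] at hre
      rw [Complex.add_im, Complex.im_ofReal_mul, Complex.ofReal_im, Complex.I_im,
        Complex.zero_im] at him
      have h1 : (1 - kp) * ω ^ 2 = -kp - 1 := by linarith
      have h2 : (1 - kd) * ω ^ 2 + (kd + 1/3) = 0 := by
        have : -ω * ((1 - kd) * ω ^ 2 + (kd + 1/3)) = 0 := by linarith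
        exact (mul_eq_zero.mp this).resolve_left (neg_ne_zero.mpr hω)
      have hk : 1 - kp ≠ 0 := by
        intro h0
        rw [h0] at h1
        linarith
      refine ⟨?_, ?_, ?_⟩
      · by_contra hc
        push Not at hc
        obtain ⟨ha, hb⟩ := hc
        have : 0 < 1 - kp := lt_of_le_of_ne (by linarith) (Ne.symm hk)
        have := mul_pos this hw
        linarith
      · linear_combination (1/2) * (1 - kp) * h2 - (1/2) * (1 - kd) * h1
      · rw [eq_div_iff hk]
        linarith
    · rintro ⟨h, hkd, hw2⟩
      have hk : 1 - kp ≠ 0 := by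
        rcases h with h | h
        · exact ne_of_gt (by linarith)
        · exact ne_of_lt (by linarith)
      rw [eq_div_iff hk] at hw2
      have h1 : -(1 - kp) * ω ^ 2 - (kp + 1) = 0 := by linarith
      have h2 : (1 - kd) * ω ^ 2 + (kd + 1/3) = 0 := by
        subst hkd
        linear_combination (2/3) * hw2
      rw [h1, h2]
      simp
  · intro kd'
    have : ((1 - kd' : ℝ) : ℂ) * (0 : ℂ) ^ 3 + ((1 - kp : ℝ) : ℂ) * (0 : ℂ) ^ 2
          - ((kd' + 1/3 : ℝ) : ℂ) * (0 : ℂ) - ((kp + 1 : ℝ) : ℂ) = ((-(kp + 1) : ℝ) : ℂ) := by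
      push_cast
      ring
    rw [this, Complex.ofReal_eq_zero]
    constructor <;> intro h <;> linarith
end

section
/- (Non-stabilizability by proportional-integral output feedback.) For every k_p ∈ ℝ and every k_i ∈ ℝ with k_i ≠ 0 there exists λ ∈ ℂ with Re λ ≥ 0 such that λ⁴ + (1 − k_p)λ³ + (−1/3 − k_i)λ² + (−1 − k_p)λ − k_i = 0. -/
open Polynomial in
lemma cubic_root (b c d : ℂ) : ∃ z : ℂ, z^3 + b*z^2 + c*z + d = 0 := by
  have hd : (X^3 + C b * X^2 + C c * X + C d : ℂ[X]).degree = 3 := by compute_degree!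
  obtain ⟨z, hz⟩ := IsAlgClosed.exists_root _ (by rw [hd]; decide)
  exact ⟨z, by simpa [IsRoot] using hz⟩

open Polynomial in
lemma quartic_root (a b c d : ℂ) : ∃ z : ℂ, z^4 + a*z^3 + b*z^2 + c*z + d = 0 := by
  have hd : (X^4 + C a * X^3 + C b * X^2 + C c * X + C d : ℂ[X]).degree = 4 := by compute_degree!
  obtain ⟨z, hz⟩ := IsAlgClosed.exists_root _ (by rw [hd]; decide)
  exact ⟨z, by simpa [IsRoot] using hz⟩

lemma cubic_factor (b c d : ℝ) : ∃ r p q : ℝ, b = p - r ∧ c = q - r*p ∧ d = -(r*q) := by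
  obtain ⟨⟨x, y⟩, hz⟩ := cubic_root b c d
  have h1 := congrArg Complex.re hz
  have h2 := congrArg Complex.im hz
  simp [pow_succ] at h1 h2
  by_cases hy : y = 0
  · subst hy
    refine ⟨x, b + x, c + x*(b+x), by ring, by ring, by linarith⟩
  · have h3 : c = x^2+y^2 - (-2*x-b)*(-2*x) := by
      apply mul_left_cancel₀ hy; linear_combination h2
    refine ⟨-2*x-b, -2*x, x^2+y^2, by ring, h3, ?_⟩
    subst h3
    linear_combination h1

lemma quartic_factor (a b c d : ℝ) : ∃ p q r s : ℝ,
    a = p + r ∧ b = q + s + p*r ∧ c = p*s + q*r ∧ d = q*s := by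
  obtain ⟨⟨x, y⟩, hz⟩ := quartic_root a b c d
  have h1 := congrArg Complex.re hz
  have h2 := congrArg Complex.im hz
  simp [pow_succ] at h1 h2
  by_cases hy : y = 0
  · subst hy
    obtain ⟨r, p, q, e1, e2, e3⟩ := cubic_factor (a+x) (b+x*(a+x)) (c+x*(b+x*(a+x)))
    refine ⟨-(x+r), x*r, p, q, by linarith, ?_, ?_, ?_⟩
    · linear_combination e2 - x*e1
    · linear_combination e3 - x*e2
    · linear_combination h1 - x*e3
  · have h3 : c = -2*x*(b-(x^2+y^2)+2*x*(a+2*x)) + (x^2+y^2)*(a+2*x) := by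
      apply mul_left_cancel₀ hy; linear_combination h2
    refine ⟨-2*x, x^2+y^2, a+2*x, b-(x^2+y^2)+2*x*(a+2*x), by ring, by ring, h3, ?_⟩
    subst h3
    linear_combination h1

lemma quad_pos (p q : ℝ) (h : ∀ z : ℂ, z^2 + p*z + q = 0 → z.re < 0) : 0 < p ∧ 0 < q := by
  rcases le_or_gt 0 (p^2-4*q) with hD | hD
  · have hs := Real.sq_sqrt hD
    have hn := Real.sqrt_nonneg (p^2-4*q)
    set s := √(p^2-4*q)
    have := h (((-p+s)/2 : ℝ) : ℂ) (by
      norm_cast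
      linear_combination hs/4)
    rw [Complex.ofReal_re] at this
    constructor <;> nlinarith
  · have hs := Real.sq_sqrt (show 0 ≤ 4*q-p^2 by linarith)
    set s := √(4*q-p^2)
    have := h ⟨-p/2, s/2⟩ (by
      apply Complex.ext <;> simp [pow_succ]
      · linear_combination -hs/4
      · ring)
    simp only at this
    constructor <;> nlinarith

/-- The third-order plant with transfer function `(s²+1)/(s³+s²−(1/3)s−1)` is not
stabilizable by PI output feedback: for all gains `k_p` and `k_i ≠ 0` the closed-loop
polynomial `λ⁴ + (1−k_p)λ³ + (−1/3−k_i)λ² + (−1−k_p)λ − k_i` has a root with `Re λ ≥ 0`. -/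
theorem stmt17 :
    ∀ kp ki : ℝ, ki ≠ 0 → ∃ lam : ℂ, 0 ≤ lam.re ∧
      lam ^ 4 + ((1 - kp : ℝ) : ℂ) * lam ^ 3 + ((-1/3 - ki : ℝ) : ℂ) * lam ^ 2
        + ((-1 - kp : ℝ) : ℂ) * lam - ((ki : ℝ) : ℂ) = 0 := by
  intro kp ki _
  by_contra! hcon
  obtain ⟨p, q, r, s, e1, e2, e3, e4⟩ := quartic_factor (1-kp) (-1/3-ki) (-1-kp) (-ki)
  have key : ∀ z : ℂ, (z^2+p*z+q)*(z^2+r*z+s) = 0 → z.re < 0 := by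
    intro z hz
    by_contra! hre
    apply hcon z hre
    have e4' : ((ki:ℝ):ℂ) = -(q*s) := by
      rw [show ki = -(q*s) by linarith]; push_cast; ring
    rw [e1, e2, e3, e4']
    push_cast
    linear_combination hz
  obtain ⟨hp, hq⟩ := quad_pos p q fun z hz => key z (by rw [hz, zero_mul])
  obtain ⟨hr, hs⟩ := quad_pos r s fun z hz => key z (by rw [hz, mul_zero])
  have hH : 0 < p*r*((q-s)^2 + (p+r)*(p*s+q*r)) := by positivity
  have hid : p*r*((q-s)^2 + (p+r)*(p*s+q*r))
      = (p+r)*(q+s+p*r)*(p*s+q*r) - (p*s+q*r)^2 - (p+r)^2*(q*s) := by ring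
  have hc : 0 < q*s := by positivity
  have hd : 0 < p*s+q*r := by positivity
  rw [hid, ← e1, ← e2, ← e3, ← e4] at hH
  rw [← e4] at hc
  rw [← e3] at hd
  nlinarith [mul_pos hc hd, mul_pos hd hd]
end

section
/- Let M be an n×n complex matrix all of whose eigenvalues have real part strictly smaller than 1, and let ε > 0. Then there exists T̂ ∈ (0, 1/ε) such that for every T ∈ (0, T̂) and every λ ∈ ℂ with Re λ > −ε, one has λT + 1 ≠ 0 and the matrix Iₙ − (1/(λT + 1))·M is invertible. -/
/-- Low-pass filter invertibility lemma: if all eigenvalues of the `n×n` complex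
matrix `M` have real part `< 1` and `ε > 0`, then there is `T̂ ∈ (0, 1/ε)` such
that for all `T ∈ (0, T̂)` and all `λ` with `Re λ > −ε` we have `λT + 1 ≠ 0` and
`Iₙ − (1/(λT+1))·M` is invertible. -/
theorem stmt18 (n : ℕ) (M : Matrix (Fin n) (Fin n) ℂ)
    (hM : ∀ μ : ℂ, (μ • (1 : Matrix (Fin n) (Fin n) ℂ) - M).det = 0 → μ.re < 1)
    (ε : ℝ) (hε : 0 < ε) :
    ∃ That : ℝ, 0 < That ∧ That < 1 / ε ∧
      ∀ T : ℝ, 0 < T → T < That → ∀ lam : ℂ, -ε < lam.re →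
        lam * (T : ℂ) + 1 ≠ 0 ∧
        IsUnit ((1 : Matrix (Fin n) (Fin n) ℂ) - (lam * (T : ℂ) + 1)⁻¹ • M) := by
  have key : ∃ δ : ℝ, 0 < δ ∧ ∀ μ : ℂ,
      (μ • (1 : Matrix (Fin n) (Fin n) ℂ) - M).det = 0 → μ.re ≤ 1 - δ := by
    have hfin : ∀ s : Finset ℂ, (∀ μ ∈ s, μ.re < 1) →
        ∃ δ : ℝ, 0 < δ ∧ ∀ μ ∈ s, μ.re ≤ 1 - δ := by
      intro s
      induction s using Finset.induction_on with
      | empty => intro _; exact ⟨1, one_pos, by simp⟩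
      | insert a s ha ih =>
        intro h
        obtain ⟨δ, hδ, h2⟩ := ih (fun μ hμ => h μ (Finset.mem_insert_of_mem hμ))
        have h1 := h a (Finset.mem_insert_self a s)
        refine ⟨min δ (1 - a.re), lt_min hδ (by linarith), ?_⟩
        intro μ hμ
        rcases Finset.mem_insert.1 hμ with rfl | hμ
        · linarith [min_le_right δ (1 - μ.re)]
        · linarith [min_le_left δ (1 - a.re), h2 μ hμ]
    have hroot : ∀ μ : ℂ, μ ∈ M.charpoly.roots.toFinset ↔
        (μ • (1 : Matrix (Fin n) (Fin n) ℂ) - M).det = 0 := by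
      intro μ
      rw [Multiset.mem_toFinset, Polynomial.mem_roots M.charpoly_monic.ne_zero,
        Polynomial.IsRoot.def, Matrix.eval_charpoly, Matrix.smul_one_eq_diagonal]
      rfl
    obtain ⟨δ, hδ, h⟩ := hfin M.charpoly.roots.toFinset
      (fun μ hμ => hM μ ((hroot μ).1 hμ))
    exact ⟨δ, hδ, fun μ hμ => h μ ((hroot μ).2 hμ)⟩
  obtain ⟨δ, hδ, h⟩ := key
  have hm : 0 < min δ (1 / 2) := lt_min hδ (by norm_num)
  have hm1 := min_le_left δ (1 / 2)
  have hm2 := min_le_right δ (1 / 2)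
  refine ⟨min δ (1 / 2) / ε, by positivity, ?_, ?_⟩
  · exact div_lt_div_of_pos_right (by linarith) hε
  intro T hT hT2 lam hlam
  rw [lt_div_iff₀ hε] at hT2
  have hre : (lam * (T : ℂ) + 1).re = lam.re * T + 1 := by simp
  have hlt : -ε * T < lam.re * T := mul_lt_mul_of_pos_right hlam hT
  have hne : lam * (T : ℂ) + 1 ≠ 0 := by
    intro h0
    rw [h0, Complex.zero_re] at hre
    nlinarith
  refine ⟨hne, ?_⟩
  have hdet : ((lam * (T : ℂ) + 1) • (1 : Matrix (Fin n) (Fin n) ℂ) - M).det ≠ 0 := by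
    intro h0
    have := h _ h0
    rw [hre] at this
    nlinarith
  have heq : (1 : Matrix (Fin n) (Fin n) ℂ) - (lam * (T : ℂ) + 1)⁻¹ • M =
      (lam * (T : ℂ) + 1)⁻¹ • ((lam * (T : ℂ) + 1) • (1 : Matrix (Fin n) (Fin n) ℂ) - M) := by
    rw [smul_sub, smul_smul, inv_mul_cancel₀ hne, one_smul]
  rw [Matrix.isUnit_iff_isUnit_det, heq, Matrix.det_smul, isUnit_iff_ne_zero]
  exact mul_ne_zero (pow_ne_zero _ (inv_ne_zero hne)) hdet
end
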